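/- arXiv:2307.06252 — 2 statements merged into one kernel-verified Lean document; each statement's English description precedes it below -/
import Mathlib

section
/- Let p > 1 and c > 0. If Mⁿ ⊂ ℝ^{n+1} is a closed, smooth, strictly convex hypersurface with support function h > 0 and Gauss curvature 𝒦 satisfying h^{p−1} e^{|Dh|²/2} 𝒦 = c on 𝕊ⁿ, then Mⁿ is a rescaling of 𝕊ⁿ. No assumption is made on the size of the constant c. -/
/-!
We work with the unit sphere `𝕊ⁿ = sphere 0 1 ⊆ ℝ^{n+1}`.  A `C²` function `u` on `𝕊ⁿ` is
represented by its positively 1-homogeneous extension `u : ℝ^{n+1} → ℝ` (which is `C²` away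
from the origin).  For such an extension, the ambient Euclidean Hessian `D²u(x)` at a point
`x ∈ 𝕊ⁿ` annihilates the radial direction `x` and its restriction to the tangent space
`x^⊥ = T_x𝕊ⁿ` coincides with the spherical bilinear form `∇̄²u + ḡ u`.  Consequently:

* the eigenvalues of `∇̄²u + ḡ u` w.r.t. `ḡ` are the eigenvalues of the ambient Hessian
  matrix other than the trivial zero radial one, so for `0 ≤ k ≤ n` the elementary symmetric
  function `σ_k(∇̄²u + ḡ u, ḡ)` equals the `k`-th elementary symmetric function of all the
  eigenvalues of the ambient Hessian matrix, which is `(-1)^k` times the coefficient of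
  `t^{n+1-k}` in its characteristic polynomial (`sigmaElem` below);
* the spherical gradient `Du(x)` is the tangential part `∇u(x) - u(x)x` of the ambient
  gradient (`sphGrad` below);
* `u` is convex (resp. the hypersurface with support function `u` is strictly convex) iff the
  Hessian form is positive semidefinite (resp. positive definite on `x^⊥`) at every `x ∈ 𝕊ⁿ`.

The spherical Lebesgue measure `μ` is the `n`-dimensional Hausdorff measure `μH[n]`.
-/

open MeasureTheory Metric
open scoped RealInnerProductSpace

noncomputable section

/-- The ambient Euclidean space `ℝ^{n+1}`. -/
abbrev Esp (n : ℕ) := EuclideanSpace ℝ (Fin (n + 1))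

/-- The ambient Hessian bilinear form `D²u(x)(v,w)` of `u : ℝ^{n+1} → ℝ`. -/
def hessForm (n : ℕ) (u : Esp n → ℝ) (x v w : Esp n) : ℝ :=
  fderiv ℝ (fun y => fderiv ℝ u y w) x v

/-- The ambient Hessian matrix of `u` at `x` in the standard orthonormal coordinates. -/
def hessMatrix (n : ℕ) (u : Esp n → ℝ) (x : Esp n) : Matrix (Fin (n + 1)) (Fin (n + 1)) ℝ :=
  Matrix.of fun i j => hessForm n u x (EuclideanSpace.single i 1) (EuclideanSpace.single j 1)

/-- For a positively 1-homogeneous `u` and `x ∈ 𝕊ⁿ`, `k ≤ n`, this is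
`σ_k(∇̄²u + ḡ u, ḡ)(x)`, the `k`-th elementary symmetric function of the eigenvalues of
`∇̄²u + ḡ u` w.r.t. `ḡ`, computed from the characteristic polynomial of the ambient Hessian. -/
def sigmaElem (n k : ℕ) (u : Esp n → ℝ) (x : Esp n) : ℝ :=
  (-1 : ℝ) ^ k * ((hessMatrix n u x).charpoly.coeff (n + 1 - k))

/-- The spherical gradient `Du(x)` at `x ∈ 𝕊ⁿ`: the tangential part of the ambient gradient. -/
def sphGrad (n : ℕ) (u : Esp n → ℝ) (x : Esp n) : Esp n :=
  gradient u x - u x • x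

/-- `u` is positively 1-homogeneous (i.e. it is the canonical extension of `u|_{𝕊ⁿ}`). -/
def PosHom (n : ℕ) (u : Esp n → ℝ) : Prop :=
  ∀ r : ℝ, 0 < r → ∀ x : Esp n, u (r • x) = r * u x

/-- The spherical Lebesgue measure on `ℝ^{n+1}` (to be restricted to `𝕊ⁿ`):
the `n`-dimensional Hausdorff measure. -/
def sphMeasure (n : ℕ) : Measure (Esp n) := μH[(n : ℝ)]


/-! ### Matrix lemmas -/

section mat
open Matrix
theorem one_le_det_of {m : ℕ} (C : Matrix (Fin m) (Fin m) ℝ) (hC : C.PosSemidef) :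
    1 ≤ (1 + C).det := by
  have hH : (1 + C).IsHermitian := (PosSemidef.one.add hC).1
  rw [hH.det_eq_prod_eigenvalues]
  have : ∀ i, 1 ≤ hH.eigenvalues i := by
    intro i
    have h1 := hH.mulVec_eigenvectorBasis i
    have h2 := hC.dotProduct_mulVec_nonneg (hH.eigenvectorBasis i)
    have h3 : C *ᵥ (hH.eigenvectorBasis i).ofLp
        = (hH.eigenvalues i - 1) • (hH.eigenvectorBasis i).ofLp := by
      rw [add_mulVec, one_mulVec] at h1
      rw [sub_smul, one_smul, ← h1]; abel
    rw [h3, dotProduct_smul] at h2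
    have h4 : star (hH.eigenvectorBasis i).ofLp ⬝ᵥ (hH.eigenvectorBasis i).ofLp = 1 := by
      have := hH.eigenvectorBasis.orthonormal.1 i
      have h5 := EuclideanSpace.real_norm_sq_eq (hH.eigenvectorBasis i)
      rw [this] at h5
      simp [dotProduct, ← pow_two] at h5 ⊢
      exact h5.symm
    rw [h4] at h2
    simp at h2; linarith
  simp only [RCLike.ofReal_real_eq_id, id_eq]
  calc (1:ℝ) = ∏ i : Fin m, 1 := by simp
    _ ≤ _ := Finset.prod_le_prod (fun _ _ => zero_le_one) (fun i _ => this i)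

theorem det_mono_posDef {m : ℕ} (A B : Matrix (Fin m) (Fin m) ℝ) (hA : A.PosDef)
    (hAB : (B - A).PosSemidef) : A.det ≤ B.det := by
  obtain ⟨L, hL, hAL⟩ : ∃ L : Matrix (Fin m) (Fin m) ℝ, IsUnit L ∧ A = Lᴴ * L := by
    open scoped MatrixOrder Matrix.Norms.L2Operator in
    exact CStarAlgebra.isStrictlyPositive_iff_eq_star_mul_self.1 hA.isStrictlyPositive
  have hd : IsUnit L.det := (Matrix.isUnit_iff_isUnit_det _).1 hL
  have hC := hAB.conjTranspose_mul_mul_same L⁻¹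
  set C := (L⁻¹)ᴴ * (B - A) * L⁻¹ with hCdef
  have hB : B = Lᴴ * (1 + C) * L := by
    have e1 : Lᴴ * (L⁻¹)ᴴ = 1 := by
      rw [← conjTranspose_mul, nonsing_inv_mul _ hd, conjTranspose_one]
    have e2 : L⁻¹ * L = 1 := nonsing_inv_mul _ hd
    have : Lᴴ * C * L = B - A := by
      calc Lᴴ * C * L = (Lᴴ * (L⁻¹)ᴴ) * (B - A) * (L⁻¹ * L) := by
            rw [hCdef]; simp only [Matrix.mul_assoc]
        _ = B - A := by rw [e1, e2]; simp
    rw [mul_add, add_mul, this, mul_one, ← hAL]; abel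
  rw [hB]; conv_lhs => rw [hAL]
  rw [det_mul, det_mul, det_mul]
  have h1 := one_le_det_of C hC
  have h2 : Lᴴ.det = L.det := by simp
  rw [h2]
  nlinarith [mul_self_nonneg L.det]

theorem tendsto_det_div {n : ℕ} (S : Matrix (Fin (n+1)) (Fin (n+1)) ℝ)
    (x : Fin (n+1) → ℝ) (hx : x ≠ 0) (hS : S *ᵥ x = 0) :
    Filter.Tendsto (fun ε : ℝ => (S + ε • (1 : Matrix _ _ ℝ)).det / ε) (nhdsWithin 0 (Set.Ioi 0))
      (nhds ((-1 : ℝ) ^ n * S.charpoly.coeff 1)) := by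
  have hdet : S.det = 0 := exists_mulVec_eq_zero_iff.1 ⟨x, hx, hS⟩
  have hc0 : S.charpoly.coeff 0 = 0 := by
    have := det_eq_sign_charpoly_coeff S
    rw [hdet] at this
    simpa using this.symm
  have key : ∀ ε : ℝ, (S + ε • (1 : Matrix _ _ ℝ)).det
      = ε * ((-1) ^ n * (S.charpoly.divX).eval (-ε)) := by
    intro ε
    have h1 := Matrix.eval_charpoly S (-ε)
    have h2 := congrArg (Polynomial.eval (-ε)) (Polynomial.divX_mul_X_add S.charpoly)
    have h3 : (scalar (Fin (n+1)) (-ε) - S) = -(S + ε • (1 : Matrix _ _ ℝ)) := by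
      rw [scalar_apply, ← smul_one_eq_diagonal]; simp; abel
    rw [h3, det_neg] at h1
    simp [hc0] at h2 h1
    rw [← h2] at h1
    have h5 : ((-1:ℝ)^n)*((-1:ℝ)^n) = 1 := by rw [← mul_pow]; simp
    rw [pow_succ] at h1
    linear_combination ((-1:ℝ)^n) * h1 - (S + ε • (1 : Matrix _ _ ℝ)).det * h5
  have hcont : Continuous fun ε : ℝ => (-1 : ℝ) ^ n * (S.charpoly.divX).eval (-ε) := by
    fun_prop
  have h0 := (hcont.tendsto 0).mono_left (nhdsWithin_le_nhds (s := Set.Ioi 0))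
  simp only [neg_zero, ← Polynomial.coeff_zero_eq_eval_zero, Polynomial.coeff_divX, zero_add] at h0
  refine h0.congr' ?_
  filter_upwards [self_mem_nhdsWithin] with ε hε
  rw [key]; field_simp [ne_of_gt (show (0:ℝ) < ε from hε)]

theorem sigma_compare {n : ℕ} (S T R : Matrix (Fin (n+1)) (Fin (n+1)) ℝ)
    (x y : Fin (n+1) → ℝ) (hx : x ≠ 0) (hS : S *ᵥ x = 0) (hy : y ≠ 0) (hT : T *ᵥ y = 0)
    (hSp : S.PosSemidef) (hTs : T.IsHermitian) (hR : Rᵀ * R = 1) (κ : ℝ) (hκ : 1 ≤ κ)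
    (hle : ∀ v, v ⬝ᵥ (S *ᵥ v) ≤ κ * ((R *ᵥ v) ⬝ᵥ (T *ᵥ (R *ᵥ v)))) :
    (-1 : ℝ) ^ n * S.charpoly.coeff 1 ≤ κ ^ (n+1) * ((-1 : ℝ) ^ n * T.charpoly.coeff 1) := by
  refine le_of_tendsto_of_tendsto (tendsto_det_div S x hx hS)
    ((tendsto_det_div T y hy hT).const_mul _) ?_
  filter_upwards [self_mem_nhdsWithin] with ε hε
  have hε : 0 < ε := hε
  rw [← mul_div_assoc]
  gcongr
  have h1 : (S + ε • (1 : Matrix _ _ ℝ)).PosDef :=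
    PosDef.posSemidef_add hSp (PosDef.one.smul hε)
  have hdR : R.det * R.det = 1 := by
    have := congrArg Matrix.det hR
    simpa using this
  have h2 : (Rᵀ * (κ • (T + ε • (1 : Matrix _ _ ℝ))) * R).det
      = κ ^ (n+1) * (T + ε • (1 : Matrix _ _ ℝ)).det := by
    rw [det_mul, det_mul, det_transpose, det_smul, Fintype.card_fin]
    linear_combination (κ ^ (n+1) * (T + ε • (1 : Matrix _ _ ℝ)).det) * hdR
  rw [← h2]
  refine det_mono_posDef _ _ h1 (PosSemidef.of_dotProduct_mulVec_nonneg ?_ ?_)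
  · refine IsHermitian.sub ?_ h1.1
    have : (κ • (T + ε • (1 : Matrix (Fin (n+1)) (Fin (n+1)) ℝ))).IsHermitian := by
      have h1 : (T + ε • (1 : Matrix (Fin (n+1)) (Fin (n+1)) ℝ)).IsHermitian :=
        hTs.add (PosDef.one.smul hε).1
      unfold IsHermitian at h1 ⊢
      rw [conjTranspose_smul, h1]; simp
    simpa using isHermitian_conjTranspose_mul_mul R this
  · intro v
    have h3 : (R *ᵥ v) ⬝ᵥ (R *ᵥ v) = v ⬝ᵥ v := by
      rw [dotProduct_mulVec, vecMul_mulVec, hR, vecMul_one]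
    have h4 : v ⬝ᵥ ((Rᵀ * (κ • (T + ε • (1 : Matrix _ _ ℝ))) * R) *ᵥ v)
        = κ * ((R *ᵥ v) ⬝ᵥ (T *ᵥ (R *ᵥ v))) + κ * ε * (v ⬝ᵥ v) := by
      rw [← h3, ← mulVec_mulVec, ← mulVec_mulVec, dotProduct_mulVec, vecMul_transpose,
        smul_mulVec, add_mulVec, smul_mulVec, one_mulVec]
      simp [dotProduct_add]; ring
    have h5 : 0 ≤ v ⬝ᵥ v := by simpa using dotProduct_star_self_nonneg v
    have h6 := hle v
    rw [star_trivial, sub_mulVec, dotProduct_sub, h4, add_mulVec, dotProduct_add, smul_mulVec, one_mulVec,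
      dotProduct_smul, smul_eq_mul]
    nlinarith [mul_nonneg (mul_nonneg (sub_nonneg.2 hκ) hε.le) h5]

end mat


/-! ### Calculus lemmas -/

theorem second_deriv_nonpos (g g' : ℝ → ℝ) (a : ℝ) (hg : ∀ t, HasDerivAt g (g' t) t)
    (hg' : HasDerivAt g' a 0) (hmax : IsLocalMax g 0) : a ≤ 0 := by
  by_contra hcon
  push Not at hcon
  have hd : deriv g = g' := funext fun t => (hg t).deriv
  have h0 : deriv g 0 = 0 := hmax.deriv_eq_zero
  have h2 : deriv (deriv g) 0 = a := by rw [hd]; exact hg'.deriv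
  have hmin : IsLocalMin g 0 :=
    isLocalMin_of_deriv_deriv_pos (by rw [h2]; exact hcon) h0 (hg 0).continuousAt
  have hconst : g =ᶠ[nhds 0] fun _ => g 0 := by
    filter_upwards [hmax, hmin] with t h1 h2
    exact le_antisymm h1 h2
  have h3 : deriv (deriv g) 0 = 0 := by
    rw [hconst.deriv.deriv_eq]; simp
  rw [h2] at h3
  exact hcon.ne' h3

section hess
open Matrix
variable {n : ℕ} {h : Esp n → ℝ}

theorem two_le_top_smooth : (2 : WithTop ℕ∞) ≤ ((⊤ : ℕ∞) : WithTop ℕ∞) := by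
  have : ((2 : ℕ∞) : WithTop ℕ∞) ≤ ((⊤ : ℕ∞) : WithTop ℕ∞) := WithTop.coe_le_coe.2 le_top
  exact this

theorem cda (hsm : ContDiffOn ℝ (⊤ : ℕ∞) h {(0 : Esp n)}ᶜ) {x : Esp n} (hx : x ≠ 0) :
    ContDiffAt ℝ (⊤ : ℕ∞) h x :=
  hsm.contDiffAt (isOpen_compl_singleton.mem_nhds hx)

theorem diff1 (hsm : ContDiffOn ℝ (⊤ : ℕ∞) h {(0 : Esp n)}ᶜ) {x : Esp n} (hx : x ≠ 0) :
    DifferentiableAt ℝ h x := (cda hsm hx).differentiableAt (by simp)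

theorem cdf (hsm : ContDiffOn ℝ (⊤ : ℕ∞) h {(0 : Esp n)}ᶜ) {x : Esp n} (hx : x ≠ 0) :
    ContDiffAt ℝ 1 (fderiv ℝ h) x :=
  ((cda hsm hx).of_le two_le_top_smooth).fderiv_right
    (by norm_num)

theorem diff2 (hsm : ContDiffOn ℝ (⊤ : ℕ∞) h {(0 : Esp n)}ᶜ) {x : Esp n} (hx : x ≠ 0) :
    DifferentiableAt ℝ (fderiv ℝ h) x := (cdf hsm hx).differentiableAt (by simp)

theorem hessForm_eq (hsm : ContDiffOn ℝ (⊤ : ℕ∞) h {(0 : Esp n)}ᶜ) {x : Esp n} (hx : x ≠ 0)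
    (v w : Esp n) : hessForm n h x v w = fderiv ℝ (fderiv ℝ h) x v w := by
  unfold hessForm
  have := ((diff2 hsm hx).hasFDerivAt.clm_apply (hasFDerivAt_const w x)).fderiv
  rw [this]; simp

theorem hess_symm (hsm : ContDiffOn ℝ (⊤ : ℕ∞) h {(0 : Esp n)}ᶜ) {x : Esp n} (hx : x ≠ 0)
    (v w : Esp n) : fderiv ℝ (fderiv ℝ h) x v w = fderiv ℝ (fderiv ℝ h) x w v :=
  (cda hsm hx).isSymmSndFDerivAt (by simpa using two_le_top_smooth) v w

theorem fderiv_hom (hhom : PosHom n h) (hsm : ContDiffOn ℝ (⊤ : ℕ∞) h {(0 : Esp n)}ᶜ)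
    {x : Esp n} (hx : x ≠ 0) (r : ℝ) (hr : 0 < r) : fderiv ℝ h (r • x) = fderiv ℝ h x := by
  have h1 : HasFDerivAt (fun y : Esp n => h (r • y)) (r • fderiv ℝ h x) x := by
    have : (fun y : Esp n => h (r • y)) = fun y => r * h y := funext fun y => hhom r hr y
    rw [this]
    exact (diff1 hsm hx).hasFDerivAt.const_mul r
  have hrx : r • x ≠ 0 := smul_ne_zero hr.ne' hx
  have h2 : HasFDerivAt (fun y : Esp n => h (r • y))
      ((fderiv ℝ h (r • x)).comp (r • ContinuousLinearMap.id ℝ (Esp n))) x :=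
    (diff1 hsm hrx).hasFDerivAt.comp x ((hasFDerivAt_id x).const_smul r)
  have h3 := h1.unique h2
  ext v
  have := congrArg (fun T => T v) h3
  simp at this
  rcases this with h | h
  · exact h.symm
  · exact absurd h hr.ne'

theorem euler1 (hhom : PosHom n h) (hsm : ContDiffOn ℝ (⊤ : ℕ∞) h {(0 : Esp n)}ᶜ)
    {x : Esp n} (hx : x ≠ 0) : fderiv ℝ h x x = h x := by
  have h1 : HasDerivAt (fun r : ℝ => h (r • x)) (fderiv ℝ h ((1:ℝ) • x) ((1:ℝ) • x)) 1 := by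
    have := (diff1 hsm (x := (1:ℝ) • x) (by simpa using hx)).hasFDerivAt.comp_hasDerivAt (1:ℝ)
      ((hasDerivAt_id (1:ℝ)).smul_const x)
    exact this
  have h2 : HasDerivAt (fun r : ℝ => h (r • x)) (h x) 1 := by
    have h3 : HasDerivAt (fun r : ℝ => r * h x) (1 * h x) 1 := (hasDerivAt_id (1:ℝ)).mul_const _
    rw [one_mul] at h3
    refine h3.congr_of_eventuallyEq ?_
    filter_upwards [lt_mem_nhds (zero_lt_one' ℝ)] with r hr
    exact hhom r hr x
  have := h1.unique h2
  simpa using this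

theorem euler2 (hhom : PosHom n h) (hsm : ContDiffOn ℝ (⊤ : ℕ∞) h {(0 : Esp n)}ᶜ)
    {x : Esp n} (hx : x ≠ 0) : fderiv ℝ (fderiv ℝ h) x x = 0 := by
  have h1 : HasDerivAt (fun r : ℝ => fderiv ℝ h (r • x))
      (fderiv ℝ (fderiv ℝ h) ((1:ℝ) • x) ((1:ℝ) • x)) 1 := by
    have := (diff2 hsm (x := (1:ℝ) • x) (by simpa using hx)).hasFDerivAt.comp_hasDerivAt (1:ℝ)
      ((hasDerivAt_id (1:ℝ)).smul_const x)
    exact this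
  have h2 : HasDerivAt (fun r : ℝ => fderiv ℝ h (r • x)) 0 1 := by
    refine (hasDerivAt_const (1:ℝ) (fderiv ℝ h x)).congr_of_eventuallyEq ?_
    filter_upwards [lt_mem_nhds (zero_lt_one' ℝ)] with r hr
    exact fderiv_hom hhom hsm hx r hr
  have := h1.unique h2
  simpa using this

theorem matrix_form (B : Esp n →L[ℝ] Esp n →L[ℝ] ℝ) (v w : Fin (n+1) → ℝ) :
    v ⬝ᵥ ((Matrix.of fun i j => B (EuclideanSpace.single i 1) (EuclideanSpace.single j 1)) *ᵥ w)
      = B (WithLp.toLp 2 v) (WithLp.toLp 2 w) := by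
  have key : ∀ u : Fin (n+1) → ℝ, WithLp.toLp 2 u
      = ∑ i, u i • (EuclideanSpace.single i (1:ℝ) : Esp n) := by
    intro u
    have := (EuclideanSpace.basisFun (Fin (n+1)) ℝ).sum_repr (WithLp.toLp 2 u)
    simpa using this.symm
  rw [key v, key w]
  simp only [map_sum, map_smul, _root_.sum_apply, _root_.smul_apply,
    dotProduct, Matrix.mulVec, Matrix.of_apply, smul_eq_mul, Finset.mul_sum]
  rw [Finset.sum_comm]
  refine Finset.sum_congr rfl fun i _ => Finset.sum_congr rfl fun j _ => by ring

theorem hessMatrix_eq (hsm : ContDiffOn ℝ (⊤ : ℕ∞) h {(0 : Esp n)}ᶜ) {x : Esp n} (hx : x ≠ 0) :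
    hessMatrix n h x = Matrix.of fun i j => fderiv ℝ (fderiv ℝ h) x
      (EuclideanSpace.single i 1) (EuclideanSpace.single j 1) := by
  unfold hessMatrix
  congr 1
  funext i j
  exact hessForm_eq hsm hx _ _

/-- First-order condition on the sphere. -/
theorem first_order (k : Esp n → ℝ) (x y w : Esp n) (hx : ‖x‖ = 1) (hy : ‖y‖ = 1) (hw : ‖w‖ = 1)
    (hxw : inner ℝ x w = 0) (hxy : x ≠ y) (hk : DifferentiableAt ℝ k x) (N : ℝ) (hN : 0 ≤ N)
    (K : ℝ) (hmax : ∀ z : Esp n, ‖z‖ = 1 → k z ≤ N * ‖z - y‖ + K) (heq : k x = N * ‖x - y‖ + K) :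
    fderiv ℝ k x w = -(N / ‖x - y‖) * inner ℝ w y := by
  set d := ‖x - y‖ with hd
  have hdpos : 0 < d := norm_pos_iff.2 (sub_ne_zero.2 hxy)
  let z : ℝ → Esp n := fun t => Real.cos t • x + Real.sin t • w
  have hz1 : ∀ t, ‖z t‖ = 1 := by
    intro t
    have : ‖z t‖ ^ 2 = 1 := by
      simp only [z]
      rw [norm_add_sq_real, norm_smul, norm_smul, inner_smul_left, inner_smul_right, hxw, hx, hw]
      simp
    nlinarith [norm_nonneg (z t)]
  have hz2 : ∀ t, ‖z t - y‖ ^ 2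
      = 2 - 2 * (Real.cos t * inner ℝ x y + Real.sin t * inner ℝ w y) := by
    intro t
    rw [norm_sub_sq_real, hz1, hy]
    simp only [z]
    rw [inner_add_left, inner_smul_left, inner_smul_left]
    simp; ring
  have hd2 : d ^ 2 = 2 - 2 * inner ℝ x y := by
    rw [hd, norm_sub_sq_real, hx, hy]; ring
  have hz0 : z 0 = x := by simp [z]
  let F : ℝ → ℝ := fun t => k (z t)
    - (N / (2 * d)) * (2 - 2 * (Real.cos t * inner ℝ x y + Real.sin t * inner ℝ w y) + d ^ 2)
  have hF : IsLocalMax F 0 := by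
    refine Filter.Eventually.of_forall fun t => ?_
    have h1 := hmax (z t) (hz1 t)
    have h2 : N * ‖z t - y‖ ≤ (N / (2 * d)) * (‖z t - y‖ ^ 2 + d ^ 2) := by
      rw [div_mul_eq_mul_div, le_div_iff₀ (by positivity)]
      nlinarith [mul_nonneg hN (sq_nonneg (‖z t - y‖ - d))]
    have h3 : F 0 = K := by
      simp only [F, hz0, heq, Real.cos_zero, Real.sin_zero]
      rw [one_mul, zero_mul, add_zero, ← hd2]; field_simp; ring
    rw [h3]
    simp only [F]
    rw [← hz2 t]
    linarith
  have hzd : HasDerivAt z w 0 := by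
    have := ((Real.hasDerivAt_cos 0).smul_const x).add ((Real.hasDerivAt_sin 0).smul_const w)
    simp at this
    exact this
  have hFd : HasDerivAt F (fderiv ℝ k x w + (N / d) * inner ℝ w y) 0 := by
    have h1 : HasDerivAt (fun t => k (z t)) (fderiv ℝ k x w) 0 := by
      have hk' : HasFDerivAt k (fderiv ℝ k x) (z 0) := by rw [hz0]; exact hk.hasFDerivAt
      exact hk'.comp_hasDerivAt (0:ℝ) hzd
    have h2 := ((((((Real.hasDerivAt_cos 0).mul_const (inner ℝ x y)).add
      ((Real.hasDerivAt_sin 0).mul_const (inner ℝ w y))).const_mul 2).const_sub 2).add_const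
        (d ^ 2)).const_mul (N / (2 * d))
    refine (h1.sub h2).congr_deriv ?_
    simp; field_simp
  have := hF.hasDerivAt_eq_zero hFd
  linarith

theorem sphGrad_norm (hhom : PosHom n h) (hsm : ContDiffOn ℝ (⊤ : ℕ∞) h {(0 : Esp n)}ᶜ)
    (x y : Esp n) (hx : ‖x‖ = 1) (hy : ‖y‖ = 1) (a : ℝ)
    (hf : ∀ w, ‖w‖ = 1 → inner ℝ x w = 0 → fderiv ℝ h x w = a * inner ℝ w y) :
    ‖sphGrad n h x‖ ^ 2 = a ^ 2 * (1 - (inner ℝ x y) ^ 2) := by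
  have hx0 : x ≠ 0 := by rintro rfl; simp at hx
  have hg : ∀ v, inner ℝ (gradient h x) v = fderiv ℝ h x v := fun v => inner_gradient_left
  have hxx : inner ℝ x x = 1 := by rw [real_inner_self_eq_norm_sq, hx]; norm_num
  have hyy : inner ℝ y y = 1 := by rw [real_inner_self_eq_norm_sq, hy]; norm_num
  set D := sphGrad n h x - a • (y - (inner ℝ x y) • x) with hD
  have hDx : inner ℝ x D = 0 := by
    rw [hD]; unfold sphGrad
    rw [inner_sub_right, inner_sub_right, inner_smul_right, inner_smul_right, inner_sub_right,
      inner_smul_right, hxx, real_inner_comm, hg, euler1 hhom hsm hx0]; ring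
  have hD0 : D = 0 := by
    by_contra hne
    have hn : 0 < ‖D‖ := norm_pos_iff.2 hne
    have h1 := hf (‖D‖⁻¹ • D) (by rw [norm_smul, norm_inv, norm_norm]; field_simp)
      (by rw [inner_smul_right, hDx, mul_zero])
    rw [map_smul, inner_smul_left] at h1
    simp only [smul_eq_mul, conj_trivial] at h1
    have h2 : fderiv ℝ h x D = a * inner ℝ D y := by
      have : ‖D‖ * (‖D‖⁻¹ * fderiv ℝ h x D) = ‖D‖ * (a * (‖D‖⁻¹ * inner ℝ D y)) := by rw [h1]
      field_simp at this
      linarith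
    have h3 : inner ℝ D D = 0 := by
      have : inner ℝ D D = inner ℝ (sphGrad n h x - a • (y - (inner ℝ x y) • x)) D := by
        rw [← hD]
      rw [this]; unfold sphGrad
      rw [inner_sub_left, inner_sub_left, inner_smul_left, inner_smul_left, inner_sub_left,
        inner_smul_left, hDx, hg, h2, real_inner_comm D y]
      simp
    exact hne (inner_self_eq_zero.1 h3)
  have h4 : sphGrad n h x = a • (y - (inner ℝ x y) • x) := sub_eq_zero.1 hD0
  rw [h4, norm_smul, mul_pow, Real.norm_eq_abs, sq_abs, norm_sub_sq_real, norm_smul,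
    inner_smul_right, hy, hx, real_inner_comm x y, Real.norm_eq_abs, mul_one, sq_abs]
  ring

/-- Second-order condition. -/
theorem second_order (hhom : PosHom n h) (hsm : ContDiffOn ℝ (⊤ : ℕ∞) h {(0 : Esp n)}ᶜ)
    (x y e w : Esp n) (d : ℝ) (hx : ‖x‖ = 1) (hy : ‖y‖ = 1) (he : ‖e‖ = 1) (hd : 0 < d)
    (hxy : x - y = d • e) (hxw : inner ℝ x w = 0) (N M : ℝ) (hM : 0 ≤ M)
    (hmax : ∀ z z' : Esp n, ‖z‖ = 1 → ‖z'‖ = 1 → h z - h z' ≤ N * ‖z - z'‖ + M)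
    (heq : h x - h y = N * d + M) :
    fderiv ℝ (fderiv ℝ h) x w w ≤ fderiv ℝ (fderiv ℝ h) y (w - (2 * inner ℝ e w) • e)
      (w - (2 * inner ℝ e w) • e) + M * ‖w‖ ^ 2 := by
  set w' := w - (2 * inner ℝ e w) • e with hw'
  have hee : inner ℝ e e = 1 := by rw [real_inner_self_eq_norm_sq, he]; norm_num
  have hxe : inner ℝ x e = d / 2 := by
    have h1 : ‖y‖ ^ 2 = ‖x‖ ^ 2 - 2 * (d * inner ℝ x e) + d ^ 2 := by
      have : y = x - d • e := by rw [← hxy]; abel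
      rw [this, norm_sub_sq_real, inner_smul_right, norm_smul, he, Real.norm_eq_abs, mul_one, sq_abs]
    rw [hx, hy] at h1
    have : d * (inner ℝ x e - d / 2) = 0 := by linarith
    rcases mul_eq_zero.1 this with h | h
    · exact absurd h hd.ne'
    · linarith
  have hyx : y = x - d • e := by rw [← hxy]; abel
  have hww : ‖w'‖ = ‖w‖ := by
    have : ‖w'‖ ^ 2 = ‖w‖ ^ 2 := by
      rw [hw', norm_sub_sq_real, inner_smul_right, norm_smul, he, Real.norm_eq_abs, mul_one, sq_abs,
        real_inner_comm]; ring
    exact (sq_eq_sq₀ (norm_nonneg _) (norm_nonneg _)).1 this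
  have hyw : inner ℝ y w' = 0 := by
    rw [hyx, hw', inner_sub_left, inner_sub_right, inner_sub_right, inner_smul_left,
      inner_smul_left, inner_smul_right, inner_smul_right, hxw, hee, hxe]
    simp; ring
  have hn : ∀ u v : Esp n, ‖u‖ = 1 → inner ℝ u v = 0 → ∀ t : ℝ,
      ‖u + t • v‖ ^ 2 = 1 + t ^ 2 * ‖v‖ ^ 2 := by
    intro u v hu huv t
    rw [norm_add_sq_real, inner_smul_right, huv, norm_smul, hu, Real.norm_eq_abs, mul_pow, sq_abs]
    ring
  have hne : ∀ u v : Esp n, ‖u‖ = 1 → inner ℝ u v = 0 → ∀ t : ℝ, u + t • v ≠ 0 := by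
    intro u v hu huv t h0
    have := hn u v hu huv t
    rw [h0] at this
    simp at this
    nlinarith [sq_nonneg (t * ‖v‖)]
  have hl : ∀ u v : Esp n, ∀ t : ℝ, HasDerivAt (fun t : ℝ => u + t • v) v t := by
    intro u v t
    simpa using ((hasDerivAt_id t).smul_const v).const_add u
  have hd1 : ∀ u v : Esp n, ‖u‖ = 1 → inner ℝ u v = 0 → ∀ t : ℝ,
      HasDerivAt (fun t : ℝ => h (u + t • v)) (fderiv ℝ h (u + t • v) v) t := by
    intro u v hu huv t
    exact (diff1 hsm (hne u v hu huv t)).hasFDerivAt.comp_hasDerivAt t (hl u v t)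
  have hd2 : ∀ u v : Esp n, ‖u‖ = 1 → inner ℝ u v = 0 →
      HasDerivAt (fun t : ℝ => fderiv ℝ h (u + t • v) v) (fderiv ℝ (fderiv ℝ h) u v v) 0 := by
    intro u v hu huv
    have h1 := (diff2 hsm (hne u v hu huv 0)).hasFDerivAt.comp_hasDerivAt (0:ℝ) (hl u v 0)
    have h2 := h1.clm_apply (hasDerivAt_const (0:ℝ) v)
    simpa using h2
  let g : ℝ → ℝ := fun t => h (x + t • w) - h (y + t • w')
    - (N * (d + t * (2 * inner ℝ e w)) + M * (1 + t ^ 2 * (‖w‖ ^ 2 / 2)))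
  let g' : ℝ → ℝ := fun t => fderiv ℝ h (x + t • w) w - fderiv ℝ h (y + t • w') w'
    - (N * (2 * inner ℝ e w) + M * (t * ‖w‖ ^ 2))
  have hg : ∀ t, HasDerivAt g (g' t) t := by
    intro t
    have h3 := (((((hasDerivAt_id t).mul_const (2 * inner ℝ e w)).const_add d).const_mul N).add
      (((((hasDerivAt_id t).pow 2).mul_const (‖w‖ ^ 2 / 2)).const_add 1).const_mul M))
    refine (((hd1 x w hx hxw t).sub (hd1 y w' hy hyw t)).sub h3).congr_deriv ?_
    simp only [g', id]; push_cast; ring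
  have hg' : HasDerivAt g' (fderiv ℝ (fderiv ℝ h) x w w - fderiv ℝ (fderiv ℝ h) y w' w'
      - M * ‖w‖ ^ 2) 0 := by
    have h3 := ((((hasDerivAt_id (0:ℝ)).mul_const (‖w‖ ^ 2)).const_mul M).const_add
      (N * (2 * inner ℝ e w)))
    refine (((hd2 x w hx hxw).sub (hd2 y w' hy hyw)).sub h3).congr_deriv ?_
    ring
  have hmaxg : IsLocalMax g 0 := by
    have hcont : Continuous fun t : ℝ => d + t * (2 * inner ℝ e w) := by fun_prop
    have hev : ∀ᶠ t in nhds (0:ℝ), 0 < d + t * (2 * inner ℝ e w) :=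
      hcont.continuousAt.eventually (lt_mem_nhds (by simpa using hd))
    filter_upwards [hev] with t ht
    have h0 : g 0 = 0 := by simp only [g]; simp; linarith
    rw [h0]
    set ρ := ‖x + t • w‖ with hρ
    have hρ2 : ρ ^ 2 = 1 + t ^ 2 * ‖w‖ ^ 2 := hn x w hx hxw t
    have hρ' : ‖y + t • w'‖ = ρ := by
      have := hn y w' hy hyw t
      rw [hww, ← hρ2] at this
      exact (sq_eq_sq₀ (norm_nonneg _) (norm_nonneg _)).1 this
    have hρpos : 0 < ρ := norm_pos_iff.2 (hne x w hx hxw t)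
    have hdiff : ‖(x + t • w) - (y + t • w')‖ = d + t * (2 * inner ℝ e w) := by
      have : (x + t • w) - (y + t • w') = (d + t * (2 * inner ℝ e w)) • e := by
        rw [hyx, hw']; module
      rw [this, norm_smul, he, Real.norm_eq_abs, abs_of_pos ht, mul_one]
    have h1 := hmax (ρ⁻¹ • (x + t • w)) (ρ⁻¹ • (y + t • w'))
      (by rw [norm_smul, norm_inv, Real.norm_eq_abs, abs_of_pos hρpos, ← hρ]; field_simp)
      (by rw [norm_smul, norm_inv, Real.norm_eq_abs, abs_of_pos hρpos, hρ']; field_simp)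
    rw [hhom _ (inv_pos.2 hρpos), hhom _ (inv_pos.2 hρpos), ← smul_sub, norm_smul, norm_inv,
      Real.norm_eq_abs, abs_of_pos hρpos, hdiff] at h1
    have h2 : h (x + t • w) - h (y + t • w') ≤ N * (d + t * (2 * inner ℝ e w)) + M * ρ := by
      have := mul_le_mul_of_nonneg_left h1 hρpos.le
      field_simp at this
      linarith
    have h3 : ρ ≤ 1 + t ^ 2 * (‖w‖ ^ 2 / 2) := by nlinarith [sq_nonneg (ρ - 1)]
    have h4 := mul_le_mul_of_nonneg_left h3 hM
    simp only [g]
    linarith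
  have := second_deriv_nonpos g g' _ hg hg' hmaxg
  linarith

end hess


/-! ### The two-point maximum principle -/

section main
open Matrix
variable {n : ℕ} {h : Esp n → ℝ}

theorem hess_lower (hsm : ContDiffOn ℝ (⊤ : ℕ∞) h {(0 : Esp n)}ᶜ)
    (hconv : ∀ x ∈ sphere (0 : Esp n) 1, ∀ v : Esp n,
      ⟪v, x⟫ = 0 → v ≠ 0 → 0 < hessForm n h x v v) :
    ∃ l : ℝ, 0 < l ∧ ∀ x v : Esp n, ‖x‖ = 1 → inner ℝ x v = 0 →
      l * ‖v‖ ^ 2 ≤ fderiv ℝ (fderiv ℝ h) x v v := by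
  let T : Set (Esp n × Esp n) :=
    (sphere (0 : Esp n) 1 ×ˢ sphere (0 : Esp n) 1) ∩ {q | inner ℝ q.1 q.2 = 0}
  have hT : IsCompact T := by
    refine ((isCompact_sphere _ _).prod (isCompact_sphere _ _)).inter_right ?_
    exact isClosed_eq (by fun_prop) continuous_const
  have hcont : ContinuousOn (fun q : Esp n × Esp n => fderiv ℝ (fderiv ℝ h) q.1 q.2 q.2) T := by
    have hc : ContinuousOn (fun q : Esp n × Esp n => fderiv ℝ (fderiv ℝ h) q.1) T := by
      intro q hq
      have hq0 : q.1 ≠ 0 := by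
        have h1 : ‖q.1‖ = 1 := by simpa using hq.1.1
        intro h0; rw [h0] at h1; simp at h1
      have h2 : ContinuousAt (fderiv ℝ (fderiv ℝ h)) q.1 :=
        ((cdf hsm hq0).fderiv_right (m := 0) (by norm_num)).continuousAt
      exact (ContinuousAt.comp (f := Prod.fst) h2 continuousAt_fst).continuousWithinAt
    exact (hc.clm_apply continuousOn_snd).clm_apply continuousOn_snd
  have hone : ∀ q ∈ T, 0 < fderiv ℝ (fderiv ℝ h) q.1 q.2 q.2 := by
    intro q hq
    have h1 : ‖q.1‖ = 1 := by simpa using hq.1.1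
    have h2 : ‖q.2‖ = 1 := by simpa using hq.1.2
    have hq1 : q.1 ≠ 0 := by intro h0; rw [h0] at h1; simp at h1
    have hq2 : q.2 ≠ 0 := by intro h0; rw [h0] at h2; simp at h2
    have h3 : inner ℝ q.1 q.2 = 0 := hq.2
    rw [← hessForm_eq hsm hq1]
    exact hconv q.1 hq.1.1 q.2 (by rw [real_inner_comm]; exact h3) hq2
  obtain ⟨l, hl, hlT⟩ : ∃ l : ℝ, 0 < l ∧ ∀ q ∈ T, l ≤ fderiv ℝ (fderiv ℝ h) q.1 q.2 q.2 := by
    rcases T.eq_empty_or_nonempty with he | hne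
    · exact ⟨1, one_pos, by simp [he]⟩
    · obtain ⟨q, hq, hmin⟩ := hT.exists_isMinOn hne hcont
      exact ⟨_, hone q hq, fun q' hq' => hmin hq'⟩
  refine ⟨l, hl, fun x v hx hxv => ?_⟩
  by_cases hv : v = 0
  · simp [hv]
  have hnv : 0 < ‖v‖ := norm_pos_iff.2 hv
  have := hlT (x, ‖v‖⁻¹ • v) ⟨⟨by simpa using hx, by
    simp [norm_smul, hnv.ne']⟩, by
    change inner ℝ x (‖v‖⁻¹ • v) = 0
    rw [inner_smul_right, hxv, mul_zero]⟩
  simp only [map_smul, _root_.smul_apply, smul_eq_mul] at this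
  have h2 := mul_le_mul_of_nonneg_right this (sq_nonneg ‖v‖)
  field_simp at h2
  linarith

/-- Comparison of the curvature functions at a maximal pair. -/
theorem sigma_le (hhom : PosHom n h) (hsm : ContDiffOn ℝ (⊤ : ℕ∞) h {(0 : Esp n)}ᶜ)
    (l : ℝ) (hl : 0 < l) (hlow : ∀ x v : Esp n, ‖x‖ = 1 → inner ℝ x v = 0 →
      l * ‖v‖ ^ 2 ≤ fderiv ℝ (fderiv ℝ h) x v v)
    (x y : Esp n) (hx : ‖x‖ = 1) (hy : ‖y‖ = 1) (hxy : x ≠ y) (N M : ℝ) (hM : 0 ≤ M)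
    (hmax : ∀ z z' : Esp n, ‖z‖ = 1 → ‖z'‖ = 1 → h z - h z' ≤ N * ‖z - z'‖ + M)
    (heq : h x - h y = N * ‖x - y‖ + M) :
    sigmaElem n n h x ≤ (1 + M / l) ^ (n + 1) * sigmaElem n n h y := by
  have hx0 : x ≠ 0 := by rintro rfl; simp at hx
  have hy0 : y ≠ 0 := by rintro rfl; simp at hy
  have hd : 0 < ‖x - y‖ := norm_pos_iff.2 (sub_ne_zero.2 hxy)
  set d := ‖x - y‖ with hdd
  let e : Esp n := d⁻¹ • (x - y)
  have he : ‖e‖ = 1 := by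
    simp only [e]; rw [norm_smul, norm_inv, Real.norm_eq_abs, abs_of_pos hd, ← hdd]; field_simp
  have hde : x - y = d • e := by simp only [e]; rw [smul_smul, mul_inv_cancel₀ hd.ne', one_smul]
  have hee : inner ℝ e e = 1 := by rw [real_inner_self_eq_norm_sq, he]; norm_num
  have hxe : inner ℝ x e = d / 2 := by
    have h1 : d ^ 2 = 2 - 2 * inner ℝ x y := by
      rw [hdd, norm_sub_sq_real, hx, hy]; ring
    simp only [e]
    rw [inner_smul_right, inner_sub_right, real_inner_self_eq_norm_sq, hx]
    field_simp; linarith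
  have hyx : y = x - d • e := by rw [← hde]; abel
  clear_value e
  let Rf : Esp n → Esp n := fun v => v - (2 * inner ℝ e v) • e
  have hRx : Rf x = y := by
    simp only [Rf]; rw [real_inner_comm, hxe, hyx]; congr 2; ring
  have hRadd : ∀ (a : ℝ) (v : Esp n), Rf (a • x + v) = a • y + Rf v := by
    intro a v
    rw [← hRx]; simp only [Rf]; rw [inner_add_right, inner_smul_right]; module
  have hRn : ∀ w, ‖Rf w‖ ^ 2 = ‖w‖ ^ 2 := by
    intro w
    simp only [Rf]
    rw [norm_sub_sq_real, inner_smul_right, norm_smul, he, Real.norm_eq_abs, mul_one, sq_abs,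
        real_inner_comm]; ring
  have hRo : ∀ w, inner ℝ x w = 0 → inner ℝ y (Rf w) = 0 := by
    intro w hxw
    simp only [Rf]
    rw [hyx, inner_sub_left, inner_sub_right, inner_sub_right, inner_smul_left,
      inner_smul_left, inner_smul_right, inner_smul_right, hxw, hee, hxe]
    simp; ring
  have hrad : ∀ u : Esp n, u ≠ 0 → ∀ (a : ℝ) (v : Esp n),
      fderiv ℝ (fderiv ℝ h) u (a • u + v) (a • u + v) = fderiv ℝ (fderiv ℝ h) u v v := by
    intro u hu a v
    have h1 := euler2 hhom hsm hu
    have h2 : fderiv ℝ (fderiv ℝ h) u v u = 0 := by rw [hess_symm hsm hu, h1]; simp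
    simp [h1, h2]
  have hdec : ∀ u : Esp n, ‖u‖ = 1 → ∀ v : Esp n,
      v = (inner ℝ u v) • u + (v - (inner ℝ u v) • u) ∧
        inner ℝ u (v - (inner ℝ u v) • u) = 0 := by
    intro u hu v
    refine ⟨by abel, ?_⟩
    rw [inner_sub_right, inner_smul_right, real_inner_self_eq_norm_sq, hu]; ring
  have hform : ∀ v : Esp n, fderiv ℝ (fderiv ℝ h) x v v
      ≤ (1 + M / l) * fderiv ℝ (fderiv ℝ h) y (Rf v) (Rf v) := by
    intro v
    obtain ⟨h1, h2⟩ := hdec x hx v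
    set w := v - (inner ℝ x v) • x
    rw [h1, hRadd, hrad x hx0, hrad y hy0]
    have h3 := second_order hhom hsm x y e w d hx hy he hd hde h2 N M hM hmax heq
    have h4 := hlow y (Rf w) hy (hRo w h2)
    rw [hRn] at h4
    have h5 : M * ‖w‖ ^ 2 ≤ M / l * fderiv ℝ (fderiv ℝ h) y (Rf w) (Rf w) := by
      rw [div_mul_eq_mul_div, le_div_iff₀ hl]
      nlinarith
    change _ ≤ fderiv ℝ (fderiv ℝ h) y (Rf w) (Rf w) + _ at h3
    linarith
  have hpsd : ∀ u : Esp n, ‖u‖ = 1 → ∀ v, 0 ≤ fderiv ℝ (fderiv ℝ h) u v v := by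
    intro u hu v
    have hu0 : u ≠ 0 := by rintro rfl; simp at hu
    obtain ⟨h1, h2⟩ := hdec u hu v
    rw [h1, hrad u hu0]
    exact le_trans (by positivity) (hlow u _ hu h2)
  have hker : ∀ u : Esp n, u ≠ 0 → hessMatrix n h u *ᵥ u.ofLp = 0 := by
    intro u hu
    have h1 : ∀ v : Fin (n+1) → ℝ, v ⬝ᵥ (hessMatrix n h u *ᵥ u.ofLp) = 0 := by
      intro v
      rw [hessMatrix_eq hsm hu, matrix_form, hess_symm hsm hu]
      change fderiv ℝ (fderiv ℝ h) u u _ = 0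
      rw [euler2 hhom hsm hu]; simp
    exact dotProduct_eq_zero _ (fun v => by rw [dotProduct_comm]; exact h1 v)
  have hherm : ∀ u : Esp n, u ≠ 0 → (hessMatrix n h u).IsHermitian := by
    intro u hu
    rw [hessMatrix_eq hsm hu]
    ext i j
    simp only [conjTranspose_apply, of_apply, star_trivial]
    exact hess_symm hsm hu _ _
  have hne : ∀ u : Esp n, u ≠ 0 → u.ofLp ≠ 0 := by
    intro u hu h0; exact hu (by ext i; exact congrFun h0 i)
  let R : Matrix (Fin (n+1)) (Fin (n+1)) ℝ := 1 - (2:ℝ) • vecMulVec e.ofLp e.ofLp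
  have hee' : e.ofLp ⬝ᵥ e.ofLp = 1 := by
    have h1 := EuclideanSpace.real_norm_sq_eq e
    rw [he] at h1
    simpa [dotProduct, pow_two] using h1.symm
  have hR : Rᵀ * R = 1 := by
    have h1 : Rᵀ = R := by simp [R, transpose_sub, transpose_smul, transpose_vecMulVec]
    rw [h1]
    simp only [R]
    rw [sub_mul, mul_sub, mul_sub, smul_mul_smul_comm, vecMulVec_mul_vecMulVec, hee']
    simp
    module
  have hRv : ∀ v : Fin (n+1) → ℝ, WithLp.toLp 2 (R *ᵥ v) = Rf (WithLp.toLp 2 v) := by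
    intro v
    have h1 : inner ℝ e (WithLp.toLp 2 v) = e.ofLp ⬝ᵥ v := by
      simp [PiLp.inner_apply, dotProduct, mul_comm]
    simp only [Rf, R]
    rw [h1, sub_mulVec, one_mulVec, smul_mulVec, vecMulVec_mulVec]
    ext i
    simp [mul_comm, mul_left_comm, mul_assoc]
  have hidx : n + 1 - n = 1 := by omega
  unfold sigmaElem
  rw [hidx]
  refine sigma_compare (hessMatrix n h x) (hessMatrix n h y) R x.ofLp y.ofLp (hne x hx0)
    (hker x hx0) (hne y hy0) (hker y hy0) ?_ (hherm y hy0) hR (1 + M / l)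
    (by have : 0 ≤ M / l := by positivity
        linarith) ?_
  · refine PosSemidef.of_dotProduct_mulVec_nonneg (hherm x hx0) fun v => ?_
    rw [hessMatrix_eq hsm hx0, matrix_form]
    exact hpsd x hx _
  · intro v
    rw [hessMatrix_eq hsm hx0, hessMatrix_eq hsm hy0, matrix_form, matrix_form, hRv]
    exact hform _

end main


/-- isotropic `L_p`-Gaussian–Minkowski problem, `p > 1`.  Let `p > 1`,
`c > 0`.  If `Mⁿ ⊆ ℝ^{n+1}` is a closed, smooth, strictly convex hypersurface with support
function `h > 0` and Gauss curvature `𝒦` satisfying `h^{p-1} e^{|Dh|²/2} 𝒦 = c` on `𝕊ⁿ`,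
then `M` is an origin-centred sphere (no assumption on the size of `c`). -/
theorem statement_5 (n : ℕ) (hn : 1 ≤ n)
    (p : ℝ) (hp : 1 < p) (c : ℝ) (hc : 0 < c)
    (h 𝒦 : Esp n → ℝ)
    (hsm : ContDiffOn ℝ (⊤ : ℕ∞) h {(0 : Esp n)}ᶜ)
    (hhom : PosHom n h)
    (hconv : ∀ x ∈ sphere (0 : Esp n) 1, ∀ v : Esp n,
      ⟪v, x⟫ = 0 → v ≠ 0 → 0 < hessForm n h x v v)
    (hpos : ∀ x ∈ sphere (0 : Esp n) 1, 0 < h x)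
    (hGauss : ∀ x ∈ sphere (0 : Esp n) 1, (𝒦 x)⁻¹ = sigmaElem n n h x)
    (heq : ∀ x ∈ sphere (0 : Esp n) 1,
      h x ^ (p - 1) * Real.exp (‖sphGrad n h x‖ ^ 2 / 2) * 𝒦 x = c) :
    ∃ r : ℝ, 0 < r ∧ ∀ x ∈ sphere (0 : Esp n) 1, h x = r := by
  have hβ : 0 < p - 1 := by linarith
  obtain ⟨l, hl, hlow⟩ := hess_lower hsm hconv
  have hs : ∀ z : Esp n, ‖z‖ = 1 → z ∈ sphere (0 : Esp n) 1 := fun z hz => by simpa using hz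
  have hn1 : ∀ z : Esp n, z ∈ sphere (0 : Esp n) 1 → ‖z‖ = 1 := fun z hz => by simpa using hz
  have hz0 : ∀ z : Esp n, ‖z‖ = 1 → z ≠ 0 := by rintro z hz rfl; simp at hz
  let e₀ : Esp n := EuclideanSpace.single 0 1
  have he₀ : ‖e₀‖ = 1 := by simp [e₀]
  have hcomp : IsCompact (sphere (0 : Esp n) 1) := isCompact_sphere _ _
  have hcont : ContinuousOn h (sphere (0 : Esp n) 1) := fun z hz =>
    (diff1 hsm (hz0 z (hn1 z hz))).continuousAt.continuousWithinAt
  -- a Lipschitz bound on the sphere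
  obtain ⟨C, hC⟩ : ∃ C, LipschitzOnWith C h (sphere (0 : Esp n) 1) := by
    refine LocallyLipschitzOn.exists_lipschitzOnWith_of_compact hcomp ?_
    intro z hz
    obtain ⟨K, t, ht, hK⟩ :=
      ((cda hsm (hz0 z (hn1 z hz))).of_le (m := 1) (by norm_num)).exists_lipschitzOnWith
    exact ⟨K, t, mem_nhdsWithin_of_mem_nhds ht, hK⟩
  by_contra hcon
  have hcon' : ∃ a b : Esp n, ‖a‖ = 1 ∧ ‖b‖ = 1 ∧ h b < h a := by
    by_contra hno
    push Not at hno
    exact hcon ⟨h e₀, hpos _ (hs _ he₀), fun z hz =>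
      le_antisymm (hno z e₀ (hn1 z hz) he₀) (hno e₀ z he₀ (hn1 z hz))⟩
  obtain ⟨a, b, ha, hb, hab⟩ := hcon'
  have habne : a ≠ b := by rintro rfl; exact lt_irrefl _ hab
  have habd : 0 < ‖a - b‖ := norm_pos_iff.2 (sub_ne_zero.2 habne)
  let S : Set ℝ := {q | ∃ x y : Esp n, ‖x‖ = 1 ∧ ‖y‖ = 1 ∧ x ≠ y ∧ q = (h x - h y) / ‖x - y‖}
  have hSb : BddAbove S := by
    refine ⟨C, ?_⟩
    rintro q ⟨x, y, hx, hy, hxy, rfl⟩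
    have hd : 0 < ‖x - y‖ := norm_pos_iff.2 (sub_ne_zero.2 hxy)
    rw [div_le_iff₀ hd]
    have h1 := hC.dist_le_mul x (hs x hx) y (hs y hy)
    rw [Real.dist_eq, dist_eq_norm] at h1
    exact (le_abs_self _).trans h1
  have hSne : S.Nonempty := ⟨_, a, b, ha, hb, habne, rfl⟩
  obtain ⟨Ns, hNs⟩ : ∃ Ns, Ns = sSup S := ⟨_, rfl⟩
  have hNspos : 0 < Ns := by
    have h1 : (h a - h b) / ‖a - b‖ ≤ Ns := by
      rw [hNs]; exact le_csSup hSb ⟨a, b, ha, hb, habne, rfl⟩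
    exact lt_of_lt_of_le (div_pos (by linarith) habd) h1
  have hle : ∀ x y : Esp n, ‖x‖ = 1 → ‖y‖ = 1 → h x - h y ≤ Ns * ‖x - y‖ := by
    intro x y hx hy
    by_cases hxy : x = y
    · simp [hxy]
    have hd : 0 < ‖x - y‖ := norm_pos_iff.2 (sub_ne_zero.2 hxy)
    rw [← div_le_iff₀ hd, hNs]
    exact le_csSup hSb ⟨x, y, hx, hy, hxy, rfl⟩
  obtain ⟨zM, hzM, hzmax⟩ := hcomp.exists_isMaxOn ⟨e₀, hs _ he₀⟩ hcont
  obtain ⟨H, hHdef⟩ : ∃ H, H = h zM := ⟨_, rfl⟩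
  have hH : 0 < H := by rw [hHdef]; exact hpos _ hzM
  have hHle : ∀ z : Esp n, ‖z‖ = 1 → h z ≤ H := by
    intro z hz; rw [hHdef]; exact hzmax (hs z hz)
  obtain ⟨δ, hδ, hδ1, hδ2⟩ : ∃ δ : ℝ, 0 < δ ∧ δ ≤ Ns / 2 ∧
      δ ≤ (p - 1) * l * Ns / (4 * H * (n + 1)) :=
    ⟨min (Ns / 2) ((p - 1) * l * Ns / (4 * H * (n + 1))), lt_min (by positivity) (by positivity),
      min_le_left _ _, min_le_right _ _⟩
  obtain ⟨N, hNdef⟩ : ∃ N, N = Ns - δ := ⟨_, rfl⟩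
  have hN : 0 < N := by linarith
  -- the maximal pair
  have hGc : ContinuousOn (fun q : Esp n × Esp n => h q.1 - h q.2 - N * ‖q.1 - q.2‖)
      (sphere (0 : Esp n) 1 ×ˢ sphere (0 : Esp n) 1) := by
    refine ContinuousOn.sub (ContinuousOn.sub ?_ ?_) ?_
    · exact hcont.comp continuousOn_fst fun q hq => hq.1
    · exact hcont.comp continuousOn_snd fun q hq => hq.2
    · exact Continuous.continuousOn (by fun_prop)
  obtain ⟨⟨x, y⟩, ⟨hxs, hys⟩, hmaxG⟩ := (hcomp.prod hcomp).exists_isMaxOn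
    ⟨(e₀, e₀), hs _ he₀, hs _ he₀⟩ hGc
  have hx : ‖x‖ = 1 := hn1 x hxs
  have hy : ‖y‖ = 1 := hn1 y hys
  obtain ⟨M, hMdef⟩ : ∃ M, M = h x - h y - N * ‖x - y‖ := ⟨_, rfl⟩
  have hmax : ∀ z z' : Esp n, ‖z‖ = 1 → ‖z'‖ = 1 → h z - h z' ≤ N * ‖z - z'‖ + M := by
    intro z z' hz hz'
    have h1 : h z - h z' - N * ‖z - z'‖ ≤ h x - h y - N * ‖x - y‖ :=
      hmaxG (Set.mk_mem_prod (hs z hz) (hs z' hz'))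
    linarith
  have hM : 0 < M := by
    have h1 : N < sSup S := by rw [← hNs]; linarith
    obtain ⟨q, ⟨u, v, hu, hv, huv, rfl⟩, hq⟩ := exists_lt_of_lt_csSup hSne h1
    have hd : 0 < ‖u - v‖ := norm_pos_iff.2 (sub_ne_zero.2 huv)
    rw [lt_div_iff₀ hd] at hq
    have := hmax u v hu hv
    linarith
  have hxy : x ≠ y := by
    rintro rfl
    simp at hMdef
    linarith
  have hd : 0 < ‖x - y‖ := norm_pos_iff.2 (sub_ne_zero.2 hxy)
  have hyx : ‖y - x‖ = ‖x - y‖ := norm_sub_rev _ _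
  have hMd : M ≤ δ * ‖x - y‖ := by
    have h1 := hle x y hx hy
    have h2 : Ns = N + δ := by linarith
    rw [h2] at h1
    linarith
  -- the gradients at the maximal pair have the same length
  have hgx := sphGrad_norm hhom hsm x y hx hy (-(N / ‖x - y‖)) (fun w hw hxw =>
    first_order h x y w hx hy hw hxw hxy (diff1 hsm (hz0 x hx)) N hN.le (h y + M)
      (fun z hz => by have := hmax z y hz hy; linarith) (by linarith))
  have hgy := sphGrad_norm hhom hsm y x hy hx (N / ‖x - y‖) (fun w hw hyw => by
    have h1 := first_order (fun z => - h z) y x w hy hx hw hyw hxy.symm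
      (diff1 hsm (hz0 y hy)).neg N hN.le (M - h x)
      (fun z hz => by
        have := hmax x z hx hz
        rw [norm_sub_rev] at this
        linarith) (by rw [hyx]; linarith)
    rw [fderiv_fun_neg, hyx] at h1
    simp only [_root_.neg_apply] at h1
    linarith)
  have hgrad : ‖sphGrad n h x‖ ^ 2 = ‖sphGrad n h y‖ ^ 2 := by
    rw [hgx, hgy, real_inner_comm]; ring
  have hsig := sigma_le hhom hsm l hl hlow x y hx hy hxy N M hM.le hmax (by linarith)
  have hsv : ∀ z : Esp n, ‖z‖ = 1 →
      sigmaElem n n h z = h z ^ (p - 1) * Real.exp (‖sphGrad n h z‖ ^ 2 / 2) / c := by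
    intro z hz
    have h1 := heq z (hs z hz)
    rw [← hGauss z (hs z hz)]
    have hK : 𝒦 z ≠ 0 := by
      intro h0; rw [h0, mul_zero] at h1; linarith
    rw [← h1]
    have h2 := Real.rpow_pos_of_pos (hpos z (hs z hz)) (p - 1)
    have h3 := Real.exp_pos (‖sphGrad n h z‖ ^ 2 / 2)
    field_simp
  rw [hsv x hx, hsv y hy, hgrad] at hsig
  have hxp := hpos x hxs
  have hyp := hpos y hys
  have hE := Real.exp_pos (‖sphGrad n h y‖ ^ 2 / 2)
  have hML : 0 < 1 + M / l := by positivity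
  have hpow : h x ^ (p - 1) ≤ (1 + M / l) ^ (n + 1) * h y ^ (p - 1) := by
    have h1 : 0 < Real.exp (‖sphGrad n h y‖ ^ 2 / 2) / c := div_pos hE hc
    rw [mul_div_assoc, mul_div_assoc, ← mul_assoc] at hsig
    exact le_of_mul_le_mul_right hsig h1
  have hyr := Real.rpow_pos_of_pos hyp (p - 1)
  have hxr := Real.rpow_pos_of_pos hxp (p - 1)
  have hlog := Real.log_le_log hxr hpow
  rw [Real.log_mul (by positivity) hyr.ne', Real.log_pow, Real.log_rpow hxp, Real.log_rpow hyp]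
    at hlog
  have hlogM : Real.log (1 + M / l) ≤ M / l := by
    have := Real.log_le_sub_one_of_pos hML
    linarith
  have hlogxy : (h x - h y) / h x ≤ Real.log (h x) - Real.log (h y) := by
    have h1 := Real.log_le_sub_one_of_pos (div_pos hyp hxp)
    rw [Real.log_div hyp.ne' hxp.ne'] at h1
    have h2 : (h x - h y) / h x = 1 - h y / h x := by field_simp
    linarith
  have hNd : N * ‖x - y‖ / H ≤ (h x - h y) / h x := by
    have h0 : N * ‖x - y‖ ≤ h x - h y := by linarith
    have h1 : 0 ≤ h x - h y := le_trans (by positivity) h0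
    exact div_le_div₀ h1 h0 hxp (hHle x hx)
  have hfin : (p - 1) * (N * ‖x - y‖ / H) ≤ (n + 1) * (δ * ‖x - y‖ / l) := by
    have h1 := mul_le_mul_of_nonneg_left (hNd.trans hlogxy) hβ.le
    have h2 : ((n : ℝ) + 1) * Real.log (1 + M / l) ≤ (n + 1) * (δ * ‖x - y‖ / l) := by
      refine mul_le_mul_of_nonneg_left (hlogM.trans ?_) (by positivity)
      exact div_le_div_of_nonneg_right hMd hl.le
    push_cast at hlog
    linarith
  have hfin2 : (p - 1) * N * l ≤ (n + 1) * δ * H := by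
    rw [← mul_div_assoc, ← mul_div_assoc, div_le_div_iff₀ hH hl] at hfin
    refine le_of_mul_le_mul_right (a := ‖x - y‖) ?_ hd
    linarith
  rw [le_div_iff₀ (by positivity)] at hδ2
  have h4 : (p - 1) * l * (Ns / 2) ≤ (p - 1) * l * N :=
    mul_le_mul_of_nonneg_left (by linarith) (by positivity)
  have h5 : 0 < (p - 1) * l * Ns := by positivity
  linarith
end
end

section
/- Let φ : (0,∞) → (0,∞) be C¹-smooth with φ' > 0. Let K and L be two smooth, strictly convex bodies in ℝ^{n+1} with positive support functions h_K, h_L and Gauss curvatures 𝒦_K, 𝒦_L (all viewed as functions on 𝕊ⁿ). If 𝒦_L / 𝒦_K = φ(h_K / h_L) on 𝕊ⁿ, then K is a rescaling of L. -/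
/-!
We work with the unit sphere `𝕊ⁿ = sphere 0 1 ⊆ ℝ^{n+1}`.  A `C²` function `u` on `𝕊ⁿ` is
represented by its positively 1-homogeneous extension `u : ℝ^{n+1} → ℝ` (which is `C²` away
from the origin).  For such an extension, the ambient Euclidean Hessian `D²u(x)` at a point
`x ∈ 𝕊ⁿ` annihilates the radial direction `x` and its restriction to the tangent space
`x^⊥ = T_x𝕊ⁿ` coincides with the spherical bilinear form `∇̄²u + ḡ u`.  Consequently:

* the eigenvalues of `∇̄²u + ḡ u` w.r.t. `ḡ` are the eigenvalues of the ambient Hessian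
  matrix other than the trivial zero radial one, so for `0 ≤ k ≤ n` the elementary symmetric
  function `σ_k(∇̄²u + ḡ u, ḡ)` equals the `k`-th elementary symmetric function of all the
  eigenvalues of the ambient Hessian matrix, which is `(-1)^k` times the coefficient of
  `t^{n+1-k}` in its characteristic polynomial (`sigmaElem` below);
* the spherical gradient `Du(x)` is the tangential part `∇u(x) - u(x)x` of the ambient
  gradient (`sphGrad` below);
* `u` is convex (resp. the hypersurface with support function `u` is strictly convex) iff the
  Hessian form is positive semidefinite (resp. positive definite on `x^⊥`) at every `x ∈ 𝕊ⁿ`.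

The spherical Lebesgue measure `μ` is the `n`-dimensional Hausdorff measure `μH[n]`.
-/

open MeasureTheory Metric
open scoped RealInnerProductSpace

noncomputable section

section PL
open scoped ENNReal Pointwise

/-- compact case of 1D Brunn–Minkowski -/
lemma bm1_compact {A B C : Set ℝ} (hA : IsCompact A) (hB : IsCompact B) (hA0 : A.Nonempty)
    (hB0 : B.Nonempty) (h : ∀ a ∈ A, ∀ b ∈ B, a + b ∈ C) :
    volume A + volume B ≤ volume C := by
  obtain ⟨b0, hb0, hb0'⟩ := hB.exists_isLeast hB0
  obtain ⟨a1, ha1, ha1'⟩ := hA.exists_isGreatest hA0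
  have e1 : volume ((fun x => b0 + x) '' A) = volume A := by
    simp [Set.image_add_left]
  have e2 : volume ((fun x => a1 + x) '' B) = volume B := by
    simp [Set.image_add_left]
  have hd : AEDisjoint volume ((fun x => b0 + x) '' A) ((fun x => a1 + x) '' B) := by
    have : ((fun x => b0 + x) '' A) ∩ ((fun x => a1 + x) '' B) ⊆ {a1 + b0} := by
      rintro _ ⟨⟨a, ha, rfl⟩, ⟨b, hb, hab⟩⟩
      have := ha1' ha
      have := hb0' hb
      simp only at hab
      simp only [Set.mem_singleton_iff]
      linarith
    exact measure_mono_null this (by simp)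
  rw [← e1, ← e2, ← measure_union₀ _ hd]
  · apply measure_mono
    rintro _ (⟨a, ha, rfl⟩ | ⟨b, hb, rfl⟩)
    · have := h a ha b0 hb0
      rwa [add_comm] at this
    · exact h a1 ha1 b hb
  · exact (hB.image (by fun_prop)).isClosed.measurableSet.nullMeasurableSet

lemma bm1 {A B C : Set ℝ} (hA : MeasurableSet A) (hB : MeasurableSet B) (hA0 : A.Nonempty)
    (hB0 : B.Nonempty) (h : ∀ a ∈ A, ∀ b ∈ B, a + b ∈ C) :
    volume A + volume B ≤ volume C := by
  obtain ⟨a, ha⟩ := hA0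
  obtain ⟨b, hb⟩ := hB0
  rw [hA.measure_eq_iSup_isCompact, hB.measure_eq_iSup_isCompact]
  simp only [iSup_and']
  refine ENNReal.biSup_add_biSup_le' ⟨∅, by simp⟩ ⟨∅, by simp⟩ ?_
  rintro K ⟨hKA, hK⟩ K' ⟨hKB, hK'⟩
  have h1 : volume K ≤ volume (insert a K) := measure_mono (Set.subset_insert _ _)
  have h2 : volume K' ≤ volume (insert b K') := measure_mono (Set.subset_insert _ _)
  refine (add_le_add h1 h2).trans ?_
  refine bm1_compact (hK.insert a) (hK'.insert b) (by simp) (by simp) ?_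
  intro x hx y hy
  exact h x (Set.insert_subset ha hKA hx) y (Set.insert_subset hb hKB hy)

lemma bm1' {t : ℝ} (ht0 : 0 < t) (ht1 : t < 1) {A B C : Set ℝ} (hA : MeasurableSet A)
    (hB : MeasurableSet B) (hA0 : A.Nonempty)
    (hB0 : B.Nonempty) (h : ∀ a ∈ A, ∀ b ∈ B, (1 - t) * a + t * b ∈ C) :
    ENNReal.ofReal (1 - t) * volume A + ENNReal.ofReal t * volume B ≤ volume C := by
  have h1 : 0 < 1 - t := by linarith
  have e1 : volume ((1 - t) • A) = ENNReal.ofReal (1 - t) * volume A := by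
    rw [Measure.addHaar_smul_of_nonneg _ h1.le]; simp
  have e2 : volume (t • B) = ENNReal.ofReal t * volume B := by
    rw [Measure.addHaar_smul_of_nonneg _ ht0.le]; simp
  rw [← e1, ← e2]
  refine bm1 (hA.const_smul₀ _) (hB.const_smul₀ _) (hA0.smul_set) (hB0.smul_set) ?_
  rintro _ ⟨a, ha, rfl⟩ _ ⟨b, hb, rfl⟩
  exact h a ha b hb

lemma layer {f : ℝ → ℝ≥0∞} (hf : Measurable f) (h1 : ∀ x, f x ≤ 1) :
    ∫⁻ x, f x = ∫⁻ s in Set.Ioo (0:ℝ) 1, volume {x | ENNReal.ofReal s < f x} := by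
  have hfin : ∀ x, f x ≠ ∞ := fun x => ne_top_of_le_ne_top ENNReal.one_ne_top (h1 x)
  have := lintegral_eq_lintegral_meas_lt (volume : Measure ℝ) (f := fun x => (f x).toReal)
    (ae_of_all _ fun x => ENNReal.toReal_nonneg) (hf.ennreal_toReal.aemeasurable)
  simp only [ENNReal.ofReal_toReal (hfin _)] at this
  rw [this, ← Set.Ioo_union_Ici_eq_Ioi (zero_lt_one (α := ℝ)),
    lintegral_union measurableSet_Ici]
  · rw [setLIntegral_congr_fun (g := fun _ => 0) measurableSet_Ici]
    · simp only [lintegral_zero, add_zero]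
      refine setLIntegral_congr_fun measurableSet_Ioo ?_
      intro s hs
      simp only
      congr 1
      ext x
      simp only [Set.mem_ofPred_eq]
      rw [ENNReal.ofReal_lt_iff_lt_toReal hs.1.le (hfin x)]
    · intro s hs
      have : {a | s < (f a).toReal} = ∅ := by
        ext x
        simp only [Set.mem_ofPred_eq, Set.mem_empty_iff_false, iff_false, not_lt]
        refine le_trans ?_ hs
        exact ENNReal.toReal_le_of_le_ofReal zero_le_one (by simpa using h1 x)
      simp [this]
  · rw [Set.disjoint_left]
    intro x hx hx'
    exact absurd hx.2 (not_lt.2 hx')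

lemma amgm {t : ℝ} (ht0 : 0 < t) (ht1 : t < 1) (a b : ℝ≥0∞) :
    a ^ (1 - t) * b ^ t ≤ ENNReal.ofReal (1 - t) * a + ENNReal.ofReal t * b := by
  have h1 : 0 < 1 - t := by linarith
  rcases eq_or_ne a ∞ with rfl | ha
  · rw [ENNReal.mul_top (by simpa using ht1)]; simp
  rcases eq_or_ne b ∞ with rfl | hb
  · rw [ENNReal.mul_top (by simpa using ht0)]; simp
  lift a to NNReal using ha
  lift b to NNReal using hb
  have := NNReal.geom_mean_le_arith_mean2_weighted (1 - t).toNNReal t.toNNReal a b (by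
    rw [← Real.toNNReal_add h1.le ht0.le]; simp)
  rw [Real.coe_toNNReal _ h1.le, Real.coe_toNNReal _ ht0.le] at this
  rw [← ENNReal.coe_rpow_of_nonneg _ h1.le, ← ENNReal.coe_rpow_of_nonneg _ ht0.le]
  unfold ENNReal.ofReal
  exact_mod_cast this

lemma pl1_norm {t : ℝ} (ht0 : 0 < t) (ht1 : t < 1) {f g h : ℝ → ℝ≥0∞}
    (hf : Measurable f) (hg : Measurable g) (hh : Measurable h)
    (hf1 : ⨆ x, f x = 1) (hg1 : ⨆ x, g x = 1)
    (H : ∀ x y, f x ^ (1 - t) * g y ^ t ≤ h ((1 - t) * x + t * y)) :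
    (∫⁻ x, f x) ^ (1 - t) * (∫⁻ x, g x) ^ t ≤ ∫⁻ x, h x := by
  have h1 : 0 < 1 - t := by linarith
  refine (amgm ht0 ht1 _ _).trans ?_
  have hm : ∀ k : ℝ → ℝ≥0∞, Measurable fun s : ℝ => volume {x | ENNReal.ofReal s < k x} := by
    intro k
    apply Antitone.measurable
    intro a b hab
    apply measure_mono
    intro x hx
    exact lt_of_le_of_lt (ENNReal.ofReal_le_ofReal hab) hx
  have hh' : ∫⁻ x, min (h x) 1 ≤ ∫⁻ x, h x := lintegral_mono fun x => min_le_left _ _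
  refine le_trans ?_ hh'
  rw [layer hf (fun x => hf1 ▸ le_iSup f x), layer hg (fun x => hg1 ▸ le_iSup g x),
    layer (hh.min measurable_const) (fun x => min_le_right _ _),
    ← lintegral_const_mul _ (hm f), ← lintegral_const_mul _ (hm g), 
    ← lintegral_add_left ((hm f).const_mul _)]
  refine setLIntegral_mono' measurableSet_Ioo ?_
  intro s hs
  have hs1 : ENNReal.ofReal s < 1 := by simpa using hs.2
  have hs0 : ENNReal.ofReal s ≠ 0 := by simpa using hs.1
  refine bm1' ht0 ht1 (measurableSet_lt measurable_const hf) (measurableSet_lt measurable_const hg)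
    ?_ ?_ ?_
  · rw [← hf1] at hs1; exact lt_iSup_iff.1 hs1
  · rw [← hg1] at hs1; exact lt_iSup_iff.1 hs1
  · intro a ha b hb
    simp only [Set.mem_ofPred_eq, lt_min_iff] at *
    refine ⟨lt_of_lt_of_le ?_ (H a b), hs1⟩
    have e : ENNReal.ofReal s = ENNReal.ofReal s ^ (1 - t) * ENNReal.ofReal s ^ t := by
      rw [← ENNReal.rpow_add _ _ hs0 ENNReal.ofReal_ne_top]; simp
    rw [e]
    exact ENNReal.mul_lt_mul (ENNReal.rpow_lt_rpow ha h1) (ENNReal.rpow_lt_rpow hb ht0)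

lemma pl1_bdd {t : ℝ} (ht0 : 0 < t) (ht1 : t < 1) {f g h : ℝ → ℝ≥0∞}
    (hf : Measurable f) (hg : Measurable g) (hh : Measurable h)
    (hf1 : ⨆ x, f x ≠ ∞) (hg1 : ⨆ x, g x ≠ ∞)
    (H : ∀ x y, f x ^ (1 - t) * g y ^ t ≤ h ((1 - t) * x + t * y)) :
    (∫⁻ x, f x) ^ (1 - t) * (∫⁻ x, g x) ^ t ≤ ∫⁻ x, h x := by
  have h1 : 0 < 1 - t := by linarith
  set A := ⨆ x, f x with hA
  set B := ⨆ x, g x with hB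
  rcases eq_or_ne A 0 with hA0 | hA0
  · have : ∀ x, f x = 0 := by simpa [hA] using hA0
    simp [this, ENNReal.zero_rpow_of_pos h1]
  rcases eq_or_ne B 0 with hB0 | hB0
  · have : ∀ x, g x = 0 := by simpa [hB] using hB0
    simp [this, ENNReal.zero_rpow_of_pos ht0]
  have hAt : A ^ (1 - t) ≠ ∞ := ENNReal.rpow_ne_top_of_nonneg h1.le hf1
  have hBt : B ^ t ≠ ∞ := ENNReal.rpow_ne_top_of_nonneg ht0.le hg1
  have hA0' : A ^ (1 - t) ≠ 0 := by simp [hA0, hf1]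
  have hB0' : B ^ t ≠ 0 := by simp [hB0, hg1]
  have key := pl1_norm ht0 ht1 (hf.const_mul A⁻¹) (hg.const_mul B⁻¹)
    (hh.const_mul (A ^ (1 - t) * B ^ t)⁻¹)
    (by rw [← ENNReal.mul_iSup, ENNReal.inv_mul_cancel hA0 hf1])
    (by rw [← ENNReal.mul_iSup, ENNReal.inv_mul_cancel hB0 hg1])
    (by
      intro x y
      rw [ENNReal.mul_rpow_of_nonneg _ _ h1.le, ENNReal.mul_rpow_of_nonneg _ _ ht0.le,
        ENNReal.inv_rpow, ENNReal.inv_rpow, ENNReal.mul_inv (Or.inl hA0') (Or.inl hAt)]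
      calc _ = (A ^ (1 - t))⁻¹ * (B ^ t)⁻¹ * (f x ^ (1 - t) * g y ^ t) := by ring
        _ ≤ _ := by gcongr; exact H x y)
  rw [lintegral_const_mul _ hf, lintegral_const_mul _ hg, lintegral_const_mul _ hh,
    ENNReal.mul_rpow_of_nonneg _ _ h1.le, ENNReal.mul_rpow_of_nonneg _ _ ht0.le,
    ENNReal.inv_rpow, ENNReal.inv_rpow] at key
  have e : ((A ^ (1 - t))⁻¹ * (∫⁻ x, f x) ^ (1 - t)) * ((B ^ t)⁻¹ * (∫⁻ x, g x) ^ t)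
      = (A ^ (1 - t) * B ^ t)⁻¹ * ((∫⁻ x, f x) ^ (1 - t) * (∫⁻ x, g x) ^ t) := by
    rw [ENNReal.mul_inv (Or.inl hA0') (Or.inl hAt)]; ring
  rw [e] at key
  exact (ENNReal.mul_le_mul_iff_right (ENNReal.inv_ne_zero.2 (ENNReal.mul_ne_top hAt hBt))
    (ENNReal.inv_ne_top.2 (mul_ne_zero hA0' hB0'))).1 key

lemma pl1 {t : ℝ} (ht0 : 0 < t) (ht1 : t < 1) {f g h : ℝ → ℝ≥0∞}
    (hf : Measurable f) (hg : Measurable g) (hh : Measurable h)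
    (H : ∀ x y, f x ^ (1 - t) * g y ^ t ≤ h ((1 - t) * x + t * y)) :
    (∫⁻ x, f x) ^ (1 - t) * (∫⁻ x, g x) ^ t ≤ ∫⁻ x, h x := by
  have h1 : 0 < 1 - t := by linarith
  have tr : ∀ k : ℝ → ℝ≥0∞, Measurable k →
      Filter.Tendsto (fun m : ℕ => ∫⁻ x, min (k x) m) Filter.atTop (nhds (∫⁻ x, k x)) := by
    intro k hk
    refine lintegral_tendsto_of_tendsto_of_monotone
      (fun m => (hk.min measurable_const).aemeasurable) ?_ ?_
    · refine ae_of_all _ fun x a b hab => ?_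
      have : (a : ℝ≥0∞) ≤ b := by exact_mod_cast hab
      exact min_le_min le_rfl this
    · refine ae_of_all _ fun x => ?_
      have := (tendsto_const_nhds (x := k x)).min ENNReal.tendsto_nat_nhds_top
      simpa using this
  have bd : ∀ m : ℕ, (∫⁻ x, min (f x) m) ^ (1 - t) * (∫⁻ x, min (g x) m) ^ t ≤ ∫⁻ x, h x := by
    intro m
    refine pl1_bdd ht0 ht1 (hf.min measurable_const) (hg.min measurable_const) hh ?_ ?_ ?_
    · exact ne_top_of_le_ne_top (ENNReal.natCast_ne_top m) (iSup_le fun x => min_le_right _ _)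
    · exact ne_top_of_le_ne_top (ENNReal.natCast_ne_top m) (iSup_le fun x => min_le_right _ _)
    · intro x y
      refine le_trans ?_ (H x y)
      gcongr <;> exact min_le_left _ _
  have bd2 : ∀ m k : ℕ, (∫⁻ x, min (f x) m) ^ (1 - t) * (∫⁻ x, min (g x) k) ^ t ≤ ∫⁻ x, h x := by
    intro m k
    refine le_trans ?_ (bd (max m k))
    have e1 : (m : ℝ≥0∞) ≤ (max m k : ℕ) := by exact_mod_cast le_max_left m k
    have e2 : (k : ℝ≥0∞) ≤ (max m k : ℕ) := by exact_mod_cast le_max_right m k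
    gcongr
  have bd3 : ∀ m : ℕ, (∫⁻ x, min (f x) m) ^ (1 - t) * (∫⁻ x, g x) ^ t ≤ ∫⁻ x, h x := by
    intro m
    rcases eq_or_ne ((∫⁻ x, min (f x) m) ^ (1 - t)) ∞ with h | h
    · rcases eq_or_ne (∫⁻ x, g x) 0 with h0 | h0
      · rw [h0, ENNReal.zero_rpow_of_pos ht0]; simp
      · have hev := (tr g hg).eventually_ne h0
        obtain ⟨k, hk⟩ := hev.exists
        have := bd2 m k
        rw [h, ENNReal.top_mul] at this
        · rw [top_le_iff.1 this]; exact le_top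
        · simp [ENNReal.rpow_eq_zero_iff, hk, not_lt.2 ht0.le]
    · exact le_of_tendsto (ENNReal.Tendsto.const_mul (((ENNReal.continuous_rpow_const).tendsto _).comp (tr g hg)) (Or.inr h))
        (Filter.Eventually.of_forall (bd2 m))
  rcases eq_or_ne ((∫⁻ x, g x) ^ t) ∞ with h | h
  · rcases eq_or_ne (∫⁻ x, f x) 0 with h0 | h0
    · rw [h0, ENNReal.zero_rpow_of_pos h1]; simp
    · have hev := (tr f hf).eventually_ne h0
      obtain ⟨k, hk⟩ := hev.exists
      have := bd3 k
      rw [h, ENNReal.mul_top] at this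
      · rw [top_le_iff.1 this]; exact le_top
      · simp only [ne_eq, ENNReal.rpow_eq_zero_iff, hk, false_and, false_or, not_and, not_lt]
        intro _; exact h1.le
  · exact le_of_tendsto (ENNReal.Tendsto.mul_const (((ENNReal.continuous_rpow_const).tendsto _).comp (tr f hf)) (Or.inr h))
        (Filter.Eventually.of_forall bd3)

theorem pl {t : ℝ} (ht0 : 0 < t) (ht1 : t < 1) (N : ℕ) : ∀ {f g h : (Fin N → ℝ) → ℝ≥0∞},
    Measurable f → Measurable g → Measurable h →
    (∀ x y, f x ^ (1 - t) * g y ^ t ≤ h ((1 - t) • x + t • y)) →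
    (∫⁻ x, f x) ^ (1 - t) * (∫⁻ x, g x) ^ t ≤ ∫⁻ x, h x := by
  induction N with
  | zero =>
    intro f g h hf hg hh H
    have e : ∀ k : (Fin 0 → ℝ) → ℝ≥0∞, ∫⁻ x, k x = k 0 := by
      intro k
      rw [lintegral_unique]
      have : (volume : Measure (Fin 0 → ℝ)) Set.univ = 1 := by
        rw [← Set.pi_univ Set.univ, volume_pi_pi]; simp
      rw [this, mul_one]; congr 1; exact Subsingleton.elim _ _
    rw [e, e, e]
    simpa using H 0 0
  | succ N ih =>
    intro f g h hf hg hh H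
    let e := MeasurableEquiv.piFinSuccAbove (fun _ : Fin (N+1) => ℝ) 0
    have he : MeasurePreserving e.symm := (volume_preserving_piFinSuccAbove (fun _ : Fin (N+1) => ℝ) 0).symm
    have elin : ∀ x y : ℝ × (Fin N → ℝ), e.symm ((1 - t) • x + t • y) = (1 - t) • e.symm x + t • e.symm y := by
      intro x y
      ext i
      refine Fin.cases ?_ ?_ i <;> simp [e, MeasurableEquiv.piFinSuccAbove, Fin.insertNthEquiv]
    have ek : ∀ k : (Fin (N+1) → ℝ) → ℝ≥0∞, Measurable k →
        ∫⁻ x, k x = ∫⁻ a : ℝ, ∫⁻ b : Fin N → ℝ, k (e.symm (a, b)) := by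
      intro k hk
      rw [← he.lintegral_comp hk, Measure.volume_eq_prod]
      exact lintegral_prod _ (hk.comp e.symm.measurable).aemeasurable
    have em : ∀ k : (Fin (N+1) → ℝ) → ℝ≥0∞, Measurable k → Measurable fun p : ℝ × (Fin N → ℝ) => k (e.symm p) :=
      fun k hk => hk.comp e.symm.measurable
    rw [ek f hf, ek g hg, ek h hh]
    refine pl1 ht0 ht1 (em f hf).lintegral_prod_right' (em g hg).lintegral_prod_right'
      (em h hh).lintegral_prod_right' ?_
    intro x y
    refine ih ((em f hf).comp measurable_prodMk_left) ((em g hg).comp measurable_prodMk_left) ((em h hh).comp measurable_prodMk_left) ?_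
    intro a b
    have := H (e.symm (x, a)) (e.symm (y, b))
    rw [← elin] at this
    simpa using this

theorem bm {t : ℝ} (ht0 : 0 < t) (ht1 : t < 1) {N : ℕ} {A B C : Set (EuclideanSpace ℝ (Fin N))}
    (hA : MeasurableSet A) (hB : MeasurableSet B) (hC : MeasurableSet C)
    (H : ∀ a ∈ A, ∀ b ∈ B, (1 - t) • a + t • b ∈ C) :
    volume A ^ (1 - t) * volume B ^ t ≤ volume C := by
  have h1 : 0 < 1 - t := by linarith
  let e := (PiLp.volume_preserving_toLp (Fin N))
  have ev : ∀ S : Set (EuclideanSpace ℝ (Fin N)), MeasurableSet S →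
      volume S = ∫⁻ x : Fin N → ℝ, (WithLp.toLp 2 ⁻¹' S).indicator 1 x := by
    intro S hS
    rw [lintegral_indicator_one (e.measurable hS), e.measure_preimage hS.nullMeasurableSet]
  rw [ev A hA, ev B hB, ev C hC]
  refine pl ht0 ht1 N (measurable_one.indicator (e.measurable hA))
    (measurable_one.indicator (e.measurable hB)) (measurable_one.indicator (e.measurable hC)) ?_
  intro x y
  by_cases hx : WithLp.toLp 2 x ∈ A
  · by_cases hy : WithLp.toLp 2 y ∈ B
    · have := H _ hx _ hy
      rw [Set.indicator_of_mem, Set.indicator_of_mem, Set.indicator_of_mem]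
      · simp
      · exact this
      · exact hy
      · exact hx
    · rw [Set.indicator_of_notMem (a := y) (by exact hy), ENNReal.zero_rpow_of_pos ht0]; simp
  · rw [Set.indicator_of_notMem (a := x) (by exact hx), ENNReal.zero_rpow_of_pos h1]; simp

end PL

section Mat
open Matrix

lemma det_one_add_vmv {N : ℕ} (a b : Fin N → ℝ) :
    (1 + vecMulVec a b).det = 1 + b ⬝ᵥ a := by
  rw [← det_one_add_replicateCol_mul_replicateRow (ι := Unit) a b, ← vecMulVec_eq]

lemma det_scal {N : ℕ} (x : Fin (N+1) → ℝ) (hx : x ⬝ᵥ x = 1) (s : ℝ) (hs : s ≠ 0) :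
    (s • (1 : Matrix (Fin (N+1)) (Fin (N+1)) ℝ) + (1 - s) • vecMulVec x x).det = s ^ N := by
  have : s • (1 : Matrix (Fin (N+1)) (Fin (N+1)) ℝ) + (1 - s) • vecMulVec x x
      = s • (1 + vecMulVec (((1 - s) / s) • x) x) := by
    rw [smul_vecMulVec, smul_add, smul_smul, mul_div_cancel₀ _ hs]
  rw [this, det_smul, det_one_add_vmv, dotProduct_smul, hx, Fintype.card_fin, pow_succ]
  simp only [smul_eq_mul, mul_one]
  field_simp
  ring

lemma vv {N : ℕ} (x : Fin N → ℝ) (hx : x ⬝ᵥ x = 1) : vecMulVec x x * vecMulVec x x = vecMulVec x x := by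
  rw [vecMulVec_mul_vecMulVec, hx, one_smul]

open Polynomial in
lemma coeff_one_charpoly {N : ℕ} (M : Matrix (Fin (N+1)) (Fin (N+1)) ℝ) (x : Fin (N+1) → ℝ)
    (hx : x ⬝ᵥ x = 1) (hM : M *ᵥ x = 0) :
    M.charpoly.coeff 1 = (-1) ^ N * (M + vecMulVec x x).det := by
  set V := vecMulVec x x with hV
  have hMV : M * V = 0 := by rw [hV, mul_vecMulVec, hM, zero_vecMulVec]
  have hVV : V * V = V := vv x hx
  let Q : ℝ[X] := ((X : ℝ[X]) • (1 - V).map C + (V - M).map C).det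
  have hQ : ∀ s, Q.eval s = (s • (1 - V) + (V - M)).det := by
    intro s
    rw [← coe_evalRingHom, RingHom.map_det]
    congr 1
    ext i j
    simp [Matrix.map_apply, Matrix.add_apply]
  have hcp : M.charpoly = X * Q := by
    refine Polynomial.funext fun s => ?_
    rw [eval_mul, hQ, eval_X, eval_charpoly]
    have : scalar (Fin (N+1)) s - M = (s • (1 - V) + (V - M)) * (1 + vecMulVec ((s - 1) • x) x) := by
      rw [smul_vecMulVec, ← hV, show scalar (Fin (N+1)) s = s • (1 : Matrix (Fin (N+1)) (Fin (N+1)) ℝ) by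
        rw [scalar_apply, ← smul_one_eq_diagonal]]
      simp only [mul_add, add_mul, sub_mul, mul_one, smul_mul_assoc, hMV, hVV, mul_smul_comm, one_mul, sub_self, smul_zero, sub_zero]
      module
    rw [this, det_mul, det_one_add_vmv, dotProduct_smul, hx]
    simp; ring
  have hc : (X * Q).coeff 1 = Q.coeff 0 := coeff_X_mul Q 0
  rw [hcp, hc, coeff_zero_eq_eval_zero, hQ]
  have : (0:ℝ) • (1 - V) + (V - M) = (M + V) * ((-1 : ℝ) • (1 + vecMulVec ((-2 : ℝ) • x) x)) := by
    rw [smul_vecMulVec, ← hV]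
    simp only [mul_add, add_mul, mul_smul_comm, mul_one, hMV, hVV]
    module
  rw [this, det_mul, det_smul, det_one_add_vmv, dotProduct_smul, hx, Fintype.card_fin]
  simp; ring

lemma det_rank_one {N : ℕ} (M : Matrix (Fin (N+1)) (Fin (N+1)) ℝ) (x p : Fin (N+1) → ℝ)
    (hx : x ⬝ᵥ x = 1) (hM : M *ᵥ x = 0) (hM' : x ᵥ* M = 0) (s : ℝ) (hs : s ≠ 0) :
    (s • M + vecMulVec p p).det = (p ⬝ᵥ x) ^ 2 * s ^ N * ((-1) ^ N * M.charpoly.coeff 1) := by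
  set V := vecMulVec x x with hV
  have hMV : M * V = 0 := by rw [hV, mul_vecMulVec, hM, zero_vecMulVec]
  have hVM : V * M = 0 := by rw [hV, vecMulVec_mul, hM', vecMulVec_zero]
  have hVV : V * V = V := vv x hx
  have e1 : s • M + vecMulVec p p = (1 + vecMulVec (p - x) x) * (s • M + V) * (1 + vecMulVec x (p - x)) := by
    have h1 : (1 + vecMulVec (p - x) x) * (s • M + V) = s • M + vecMulVec p x := by
      rw [add_mul, one_mul, mul_add, mul_smul_comm, vecMulVec_mul, hM', hV,
        vecMulVec_mul_vecMulVec, hx, sub_vecMulVec]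
      simp
      rw [sub_vecMulVec]; abel
    have h2 : (s • M + vecMulVec p x) * (1 + vecMulVec x (p - x)) = s • M + vecMulVec p p := by
      rw [mul_add, mul_one, add_mul, smul_mul_assoc, mul_vecMulVec, hM, 
        vecMulVec_mul_vecMulVec, hx, vecMulVec_smul, one_smul, vecMulVec_sub]
      simp
      rw [vecMulVec_sub]; abel
    rw [h1, h2]
  have e2 : s • M + V = (M + V) * (s • (1 : Matrix (Fin (N+1)) (Fin (N+1)) ℝ) + (1 - s) • V) := by
    simp only [mul_add, add_mul, mul_smul_comm, mul_one, hMV, hVV]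
    module
  rw [e1, det_mul, det_mul, e2, det_mul, det_scal x hx s hs, det_one_add_vmv, det_one_add_vmv,
    coeff_one_charpoly M x hx hM, dotProduct_sub, sub_dotProduct, hx, dotProduct_comm x p, ← mul_assoc ((-1)^N), ← mul_pow, ← hV]
  simp; ring
end Mat

section Polar
open Set Measure

lemma volumeIoiPow_Iic (n : ℕ) (x : Ioi (0 : ℝ)) :
    volumeIoiPow n (Iic x) = ENNReal.ofReal (x.1 ^ (n + 1) / (n + 1)) := by
  rw [← volumeIoiPow_apply_Iio, ← Iio_union_right]
  apply le_antisymm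
  · refine (measure_union_le _ _).trans ?_
    have : volumeIoiPow n {x} = 0 := by
      rw [volumeIoiPow]
      apply withDensity_absolutelyContinuous
      rw [comap_subtype_coe_apply measurableSet_Ioi]
      simp
    simp [this]
  · exact measure_mono subset_union_left

lemma polar {n : ℕ} (S : Set (Esp n)) (hS : MeasurableSet S) 
    (ρ : sphere (0 : Esp n) 1 → ℝ) (hρ : ∀ θ, 0 < ρ θ)
    (h : ∀ θ : sphere (0 : Esp n) 1, ∀ r : ℝ, 0 < r → (r • (θ : Esp n) ∈ S ↔ r ≤ ρ θ))
    (F : Esp n → ENNReal) (hF : Measurable F)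
    (hF0 : ∀ r : ℝ, 0 < r → ∀ x, x ≠ 0 → F (r • x) = F x) :
    ∫⁻ x in S, F x = ∫⁻ θ, F (θ : Esp n) * ENNReal.ofReal (ρ θ ^ (n+1) / (n+1))
      ∂(volume : Measure (Esp n)).toSphere := by
  have hm := (volume : Measure (Esp n)).measurePreserving_homeomorphUnitSphereProd
  have hd : Module.finrank ℝ (Esp n) - 1 = n := by simp
  rw [hd] at hm
  have h1 : ∫⁻ x in S, F x = ∫⁻ x : ({(0:(Esp n))}ᶜ : Set (Esp n)), S.indicator F x ∂(Measure.comap Subtype.val (volume : Measure (Esp n))) := by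
    rw [lintegral_subtype_comap (measurableSet_singleton _).compl, restrict_compl_singleton,
      lintegral_indicator hS]
  have hms : MeasurePreserving (homeomorphUnitSphereProd (Esp n)).symm _ _ := MeasurePreserving.symm (homeomorphUnitSphereProd (Esp n)).toMeasurableEquiv hm
  have h2 := hms.lintegral_comp (f := fun x : ({(0:(Esp n))}ᶜ : Set (Esp n)) => S.indicator F x) ((hF.indicator hS).comp measurable_subtype_coe)
  have hind : ∀ p : sphere (0:(Esp n)) 1 × Ioi (0:ℝ), S.indicator F ((homeomorphUnitSphereProd (Esp n)).symm p : (Esp n))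
    = F p.1 * (Iic (⟨ρ p.1, Set.mem_Ioi.2 (hρ p.1)⟩ : Ioi (0:ℝ))).indicator 1 p.2 := by
    rintro ⟨θ, r, hr⟩
    have e : ((homeomorphUnitSphereProd (Esp n)).symm (θ, ⟨r, hr⟩) : (Esp n)) = r • (θ : (Esp n)) := by simp
    rw [e]
    have hθ : (θ : (Esp n)) ≠ 0 := by
      intro h0
      have := θ.2
      rw [h0] at this
      simp at this
    by_cases hrr : r ≤ ρ θ
    · rw [indicator_of_mem ((h θ r hr).2 hrr), indicator_of_mem, hF0 r hr _ hθ]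
      · simp
      · exact hrr
    · rw [indicator_of_notMem (fun hc => hrr ((h θ r hr).1 hc)), indicator_of_notMem]
      · simp
      · exact hrr
  have hmm : Measurable fun p => S.indicator F ((homeomorphUnitSphereProd (Esp n)).symm p : (Esp n)) :=
    (hF.indicator hS).comp (measurable_subtype_coe.comp (homeomorphUnitSphereProd (Esp n)).symm.measurable)
  rw [h1, ← h2]
  refine (lintegral_prod _ hmm.aemeasurable).trans ?_
  refine lintegral_congr fun θ => ?_
  have hy : ∀ y, S.indicator F ((homeomorphUnitSphereProd (Esp n)).symm (θ, y) : Esp n)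
      = F θ * (Iic (⟨ρ θ, Set.mem_Ioi.2 (hρ θ)⟩ : Ioi (0:ℝ))).indicator 1 y := fun y => hind (θ, y)
  rw [lintegral_congr hy]
  rw [lintegral_const_mul _ (measurable_one.indicator measurableSet_Iic), lintegral_indicator_one measurableSet_Iic, volumeIoiPow_Iic]
end Polar

section Analysis
open scoped Gradient

structure Good (n : ℕ) (u : Esp n → ℝ) : Prop where
  sm : ContDiffOn ℝ (⊤ : ℕ∞) u {(0 : Esp n)}ᶜ
  hom : PosHom n u
  conv : ∀ x ∈ sphere (0 : Esp n) 1, ∀ v : Esp n, ⟪v, x⟫ = 0 → v ≠ 0 → 0 < hessForm n u x v v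
  pos : ∀ x ∈ sphere (0 : Esp n) 1, 0 < u x

def Tm (n : ℕ) (u : Esp n → ℝ) (x : Esp n) : Esp n := u x • gradient u x

/-- Wulff body -/
def body (n : ℕ) (u : Esp n → ℝ) : Set (Esp n) := {y | ∀ x, ⟪x, y⟫ ≤ u x}

variable {n : ℕ} {u : Esp n → ℝ}

lemma inner_grad (x v : Esp n) : ⟪gradient u x, v⟫ = fderiv ℝ u x v := by
  rw [gradient, InnerProductSpace.toDual_symm_apply]

lemma hom_pos (hh : PosHom n u) (hp : ∀ x ∈ sphere (0 : Esp n) 1, 0 < u x) {x : Esp n}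
    (hx : x ≠ 0) : 0 < u x := by
  have hx' : 0 < ‖x‖ := norm_pos_iff.2 hx
  have e : x = ‖x‖ • (‖x‖⁻¹ • x) := by rw [smul_smul, mul_inv_cancel₀ hx'.ne', one_smul]
  rw [e, hh _ hx']
  refine mul_pos hx' (hp _ ?_)
  simp [norm_smul, hx'.ne']

lemma hom_zero (hh : PosHom n u) : u 0 = 0 := by
  have := hh 2 two_pos 0
  rw [smul_zero] at this
  linarith

namespace Good

lemma upos (G : Good n u) {x : Esp n} (hx : x ≠ 0) : 0 < u x := hom_pos G.hom G.pos hx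

lemma cda (G : Good n u) {x : Esp n} (hx : x ≠ 0) : ContDiffAt ℝ (⊤ : ℕ∞) u x :=
  G.sm.contDiffAt (isOpen_compl_singleton.mem_nhds hx)

lemma cda1 (G : Good n u) {x : Esp n} (hx : x ≠ 0) : ContDiffAt ℝ (⊤ : ℕ∞) (fderiv ℝ u) x :=
  (G.cda hx).fderiv_right (by simp)

lemma hd (G : Good n u) {x : Esp n} (hx : x ≠ 0) : HasFDerivAt u (fderiv ℝ u x) x :=
  ((G.cda hx).differentiableAt (by simp)).hasFDerivAt

lemma hd2 (G : Good n u) {x : Esp n} (hx : x ≠ 0) : HasFDerivAt (fderiv ℝ u) (fderiv ℝ (fderiv ℝ u) x) x :=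
  ((G.cda1 hx).differentiableAt (by simp)).hasFDerivAt

lemma hd2v (G : Good n u) {x : Esp n} (hx : x ≠ 0) (w : Esp n) :
    HasFDerivAt (fun y => fderiv ℝ u y w) ((fderiv ℝ (fderiv ℝ u) x).flip w) x := by
  have := (G.hd2 hx).clm_apply (hasFDerivAt_const w x)
  simpa using this

lemma hess_eq (G : Good n u) {x : Esp n} (hx : x ≠ 0) (v w : Esp n) :
    hessForm n u x v w = fderiv ℝ (fderiv ℝ u) x v w := by
  rw [hessForm, (G.hd2v hx w).fderiv]
  rfl

lemma sym (G : Good n u) {x : Esp n} (hx : x ≠ 0) (v w : Esp n) :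
    fderiv ℝ (fderiv ℝ u) x v w = fderiv ℝ (fderiv ℝ u) x w v :=
  ((G.cda hx).isSymmSndFDerivAt (by simp only [minSmoothness_of_isRCLikeNormedField]; exact WithTop.coe_le_coe.2 (le_top (a := (2:ℕ∞))))).eq v w

lemma fderiv_smul (G : Good n u) {x : Esp n} (hx : x ≠ 0) {r : ℝ} (hr : 0 < r) :
    fderiv ℝ u (r • x) = fderiv ℝ u x := by
  have h1 : HasFDerivAt (fun y => u (r • y)) ((fderiv ℝ u (r • x)).comp (r • ContinuousLinearMap.id ℝ (Esp n))) x :=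
    HasFDerivAt.comp x (G.hd (smul_ne_zero hr.ne' hx)) ((hasFDerivAt_id x).const_smul r)
  have h2 : HasFDerivAt (fun y => u (r • y)) (r • fderiv ℝ u x) x := by
    have : (fun y => u (r • y)) = fun y => r * u y := by ext y; exact G.hom r hr y
    rw [this]
    exact (G.hd hx).const_mul r
  have := h1.unique h2
  ext v
  have := congrArg (fun L => L v) this
  simp at this
  rcases this with h | h
  · exact h
  · exact absurd h hr.ne'

lemma fderiv2_smul (G : Good n u) {x : Esp n} (hx : x ≠ 0) {r : ℝ} (hr : 0 < r) (v w : Esp n) :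
    r * fderiv ℝ (fderiv ℝ u) (r • x) v w = fderiv ℝ (fderiv ℝ u) x v w := by
  have h1 : HasFDerivAt (fun y => fderiv ℝ u (r • y)) ((fderiv ℝ (fderiv ℝ u) (r • x)).comp (r • ContinuousLinearMap.id ℝ (Esp n))) x :=
    HasFDerivAt.comp x (G.hd2 (smul_ne_zero hr.ne' hx)) ((hasFDerivAt_id x).const_smul r)
  have h2 : HasFDerivAt (fun y => fderiv ℝ u (r • y)) (fderiv ℝ (fderiv ℝ u) x) x := by
    refine (G.hd2 hx).congr_of_eventuallyEq ?_
    filter_upwards [isOpen_compl_singleton.mem_nhds hx] with y hy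
    exact G.fderiv_smul hy hr
  have := congrArg (fun L => L v w) (h1.unique h2)
  simpa using this

lemma euler (G : Good n u) {x : Esp n} (hx : x ≠ 0) : fderiv ℝ u x x = u x := by
  have h0 : HasDerivAt (fun r : ℝ => r • x) x 1 := by
    simpa using (hasDerivAt_id (1:ℝ)).smul_const x
  have h1 : HasDerivAt (fun r : ℝ => u (r • x)) (fderiv ℝ u x x) 1 := by
    have h : HasFDerivAt u (fderiv ℝ u x) ((1:ℝ) • x) := by rw [one_smul]; exact G.hd hx
    exact h.comp_hasDerivAt (1:ℝ) h0
  have h2 : HasDerivAt (fun r : ℝ => u (r • x)) (u x) 1 := by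
    have : HasDerivAt (fun r : ℝ => r * u x) (u x) 1 := by simpa using (hasDerivAt_id (1:ℝ)).mul_const (u x)
    refine this.congr_of_eventuallyEq ?_
    filter_upwards [lt_mem_nhds (zero_lt_one (α := ℝ))] with r hr
    exact G.hom r hr x
  exact h1.unique h2

lemma euler2 (G : Good n u) {x : Esp n} (hx : x ≠ 0) : fderiv ℝ (fderiv ℝ u) x x = 0 := by
  have h0 : HasDerivAt (fun r : ℝ => r • x) x 1 := by
    simpa using (hasDerivAt_id (1:ℝ)).smul_const x
  have h1 : HasDerivAt (fun r : ℝ => fderiv ℝ u (r • x)) (fderiv ℝ (fderiv ℝ u) x x) 1 := by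
    have h : HasFDerivAt (fderiv ℝ u) (fderiv ℝ (fderiv ℝ u) x) ((1:ℝ) • x) := by rw [one_smul]; exact G.hd2 hx
    exact h.comp_hasDerivAt (1:ℝ) h0
  have h2 : HasDerivAt (fun r : ℝ => fderiv ℝ u (r • x)) 0 1 := by
    refine (hasDerivAt_const (1:ℝ) (fderiv ℝ u x)).congr_of_eventuallyEq ?_
    filter_upwards [lt_mem_nhds (zero_lt_one (α := ℝ))] with r hr
    exact G.fderiv_smul hx hr
  exact h1.unique h2

lemma hess_pos (G : Good n u) {x : Esp n} (hx : x ≠ 0) {v : Esp n} (hv : ∀ c : ℝ, v ≠ c • x) :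
    0 < fderiv ℝ (fderiv ℝ u) x v v := by
  have hx' : 0 < ‖x‖ := norm_pos_iff.2 hx
  have hxi : 0 < ‖x‖⁻¹ := inv_pos.2 hx'
  set c := ⟪v, x⟫ / ‖x‖ ^ 2 with hc
  set w := v - c • x with hw
  have hw0 : w ≠ 0 := sub_ne_zero.2 (hv c)
  have hwx : ⟪w, x⟫ = 0 := by
    rw [hw, inner_sub_left, real_inner_smul_left, real_inner_self_eq_norm_sq, hc]
    field_simp; ring
  have e1 : fderiv ℝ (fderiv ℝ u) x v v = fderiv ℝ (fderiv ℝ u) x w w := by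
    have : v = w + c • x := by rw [hw]; abel
    rw [this]
    simp only [map_add, map_smul, G.euler2 hx, smul_zero, add_zero]
    rw [G.sym hx w x, G.euler2 hx]; simp
  rw [e1, ← G.fderiv2_smul hx hxi]
  refine mul_pos hxi ?_
  rw [← G.hess_eq (smul_ne_zero hxi.ne' hx)]
  refine G.conv _ (by simp [norm_smul, hx'.ne']) _ ?_ hw0
  rw [real_inner_smul_right, hwx, mul_zero]

lemma strict (G : Good n u) {x z : Esp n} (hx : x ≠ 0) (hz : ∀ c : ℝ, z ≠ c • x) : fderiv ℝ u x z < u z := by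
  set v := z - x with hv
  have hne : ∀ s : ℝ, x + s • v ≠ 0 := by
    intro s hs
    rcases eq_or_ne s 0 with rfl | h0
    · simp at hs; exact hx hs
    · apply hz ((s - 1) / s)
      have : s • z = (s - 1) • x := by
        rw [hv] at hs
        have : s • z - (s - 1) • x = x + s • (z - x) := by module
        rw [hs] at this; exact sub_eq_zero.1 this
      rw [div_eq_inv_mul, ← smul_smul, ← this, smul_smul, inv_mul_cancel₀ h0, one_smul]
  have hnp : ∀ s c : ℝ, v ≠ c • (x + s • v) := by
    intro s c h
    have h2 : (1 - c * s) • z = (c + 1 - c * s) • x := by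
      rw [hv] at h
      have : (1 - c * s) • z - (c + 1 - c * s) • x = (z - x) - c • (x + s • (z - x)) := by module
      rw [← h, sub_self] at this; exact sub_eq_zero.1 this
    rcases eq_or_ne (1 - c * s) 0 with h0 | h0
    · rw [h0, zero_smul, show c + 1 - c * s = c by linarith] at h2
      rcases smul_eq_zero.1 h2.symm with h3 | h3
      · rw [h3] at h0; simp at h0
      · exact hx h3
    · apply hz ((1 - c * s)⁻¹ * (c + 1 - c * s))
      rw [← smul_smul, ← h2, smul_smul, inv_mul_cancel₀ h0, one_smul]
  have hl : ∀ s : ℝ, HasDerivAt (fun s : ℝ => x + s • v) v s := by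
    intro s
    simpa using ((hasDerivAt_id s).smul_const v).const_add x
  have h1 : ∀ s : ℝ, HasDerivAt (fun s : ℝ => u (x + s • v)) (fderiv ℝ u (x + s • v) v) s :=
    fun s => (G.hd (hne s)).comp_hasDerivAt s (hl s)
  have h2 : ∀ s : ℝ, HasDerivAt (fun s : ℝ => fderiv ℝ u (x + s • v) v)
      (fderiv ℝ (fderiv ℝ u) (x + s • v) v v) s := by
    intro s
    exact (G.hd2v (hne s) v).comp_hasDerivAt s (hl s)
  have hmono : StrictMono fun s : ℝ => fderiv ℝ u (x + s • v) v := by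
    refine strictMono_of_deriv_pos fun s => ?_
    rw [(h2 s).deriv]
    exact G.hess_pos (hne s) (hnp s)
  obtain ⟨ξ, hξ, he⟩ := exists_hasDerivAt_eq_slope _ _ (zero_lt_one (α := ℝ))
    (fun s _ => (h1 s).continuousAt.continuousWithinAt) (fun s _ => h1 s)
  have hlt := hmono hξ.1
  simp only [zero_smul, add_zero, one_smul, sub_zero, div_one] at he hlt
  rw [he, hv, map_sub, G.euler hx] at hlt
  rw [show x + (z - x) = z by abel] at hlt
  linarith

lemma le (G : Good n u) {x : Esp n} (hx : x ≠ 0) (z : Esp n) : fderiv ℝ u x z ≤ u z := by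
  by_cases hz : ∀ c : ℝ, z ≠ c • x
  · exact (G.strict hx hz).le
  · push Not at hz
    obtain ⟨c, rfl⟩ := hz
    rw [map_smul, G.euler hx, smul_eq_mul]
    rcases lt_trichotomy c 0 with h | h | h
    · have h1 : c • x ≠ 0 := smul_ne_zero h.ne hx
      nlinarith [G.upos h1, G.upos hx]
    · subst h; simp [hom_zero G.hom]
    · rw [G.hom c h]

lemma Tm_inner (G : Good n u) (x v : Esp n) : ⟪Tm n u x, v⟫ = u x * fderiv ℝ u x v := by
  rw [Tm, real_inner_smul_left, inner_grad]

lemma inj (G : Good n u) : Set.InjOn (Tm n u) {(0 : Esp n)}ᶜ := by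
  intro x hx z hz h
  have hx : x ≠ 0 := hx
  have hz : z ≠ 0 := hz
  have key : ∀ v, u x * fderiv ℝ u x v = u z * fderiv ℝ u z v := by
    intro v; rw [← G.Tm_inner, ← G.Tm_inner, h]
  have ux := G.upos hx
  have uz := G.upos hz
  have a1 := key z
  have a2 := key x
  rw [G.euler hz] at a1
  rw [G.euler hx] at a2
  have b1 := G.le hx z
  have b2 := G.le hz x
  have c1 : u z ≤ u x := by
    by_contra hc; push Not at hc; nlinarith
  have c2 : u x ≤ u z := by
    by_contra hc; push Not at hc; nlinarith
  have c3 : u x = u z := le_antisymm c2 c1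
  have d : fderiv ℝ u x z = u z := by
    rw [c3] at a1; exact mul_left_cancel₀ uz.ne' a1
  by_cases hzz : ∀ c : ℝ, z ≠ c • x
  · exact absurd d (G.strict hx hzz).ne
  · push Not at hzz
    obtain ⟨c, rfl⟩ := hzz
    rw [map_smul, G.euler hx, smul_eq_mul, ← c3] at d
    have : c = 1 := by
      have : (c - 1) * u x = 0 := by linarith
      rcases mul_eq_zero.1 this with h | h
      · linarith
      · exact absurd h ux.ne'
    rw [this, one_smul]

lemma surj (G : Good n u) {y : Esp n} (hy : y ≠ 0) : ∃ x, x ≠ 0 ∧ Tm n u x = y := by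
  have hne : ∀ x ∈ sphere (0 : Esp n) 1, x ≠ 0 := by
    rintro x hx rfl; simp at hx
  have hcont : ContinuousOn (fun x => ⟪x, y⟫ / u x) (sphere (0 : Esp n) 1) := by
    refine ContinuousOn.div (by fun_prop) (G.sm.continuousOn.mono fun x hx => hne x hx) ?_
    intro x hx; exact (G.pos x hx).ne'
  have hy' : 0 < ‖y‖ := norm_pos_iff.2 hy
  have hys : ‖y‖⁻¹ • y ∈ sphere (0 : Esp n) 1 := by simp [norm_smul, hy'.ne']
  obtain ⟨x0, hx0, hmax⟩ := (isCompact_sphere (0 : Esp n) 1).exists_isMaxOn ⟨_, hys⟩ hcont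
  set μ := ⟪x0, y⟫ / u x0 with hμ
  have hx00 := hne x0 hx0
  have hμ0 : 0 < μ := by
    refine lt_of_lt_of_le ?_ (hmax hys)
    refine div_pos ?_ (G.pos _ hys)
    rw [real_inner_smul_left, real_inner_self_eq_norm_sq]; positivity
  have hall : ∀ x, x ≠ 0 → ⟪x, y⟫ ≤ μ * u x := by
    intro x hx
    have hx' : 0 < ‖x‖ := norm_pos_iff.2 hx
    have hxs : ‖x‖⁻¹ • x ∈ sphere (0 : Esp n) 1 := by simp [norm_smul, hx'.ne']
    have := hmax hxs
    simp only [Set.mem_ofPred_eq] at this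
    rw [real_inner_smul_left, G.hom _ (inv_pos.2 hx'), mul_div_mul_left _ _ (inv_pos.2 hx').ne',
      div_le_iff₀ (G.upos hx)] at this
    exact this
  have hmin : IsLocalMin (fun x => μ * u x - ⟪y, x⟫) x0 := by
    filter_upwards [isOpen_compl_singleton.mem_nhds hx00] with x hx
    have e : μ * u x0 - ⟪y, x0⟫ = 0 := by
      rw [hμ, div_mul_cancel₀ _ (G.pos x0 hx0).ne', real_inner_comm]; ring
    rw [e]
    have := hall x hx
    rw [real_inner_comm] at this
    linarith
  have hder : HasFDerivAt (fun x => μ * u x - ⟪y, x⟫) (μ • fderiv ℝ u x0 - innerSL ℝ y) x0 :=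
    ((G.hd hx00).const_mul μ).sub ((innerSL ℝ y).hasFDerivAt)
  have h0 := hmin.hasFDerivAt_eq_zero hder
  have hr : 0 < μ / u x0 := div_pos hμ0 (G.pos x0 hx0)
  refine ⟨(μ / u x0) • x0, smul_ne_zero hr.ne' hx00, ?_⟩
  refine ext_inner_right ℝ fun v => ?_
  rw [G.Tm_inner, G.hom _ hr, G.fderiv_smul hx00 hr, div_mul_cancel₀ _ (G.pos x0 hx0).ne']
  have := congrArg (fun L => L v) h0
  simp at this
  linarith

lemma Tm_smul (G : Good n u) {x : Esp n} (hx : x ≠ 0) {r : ℝ} (hr : 0 < r) : Tm n u (r • x) = r • Tm n u x := by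
  refine ext_inner_right ℝ fun v => ?_
  rw [real_inner_smul_left, G.Tm_inner, G.Tm_inner, G.hom r hr, G.fderiv_smul hx hr]; ring

lemma Tm_cd (G : Good n u) {x : Esp n} (hx : x ≠ 0) : ContDiffAt ℝ (⊤ : ℕ∞) (Tm n u) x := by
  refine (G.cda hx).smul ?_
  exact ((InnerProductSpace.toDual ℝ (Esp n)).symm.toContinuousLinearEquiv.toContinuousLinearMap.contDiff.contDiffAt).comp x (G.cda1 hx)

lemma Tm_hd (G : Good n u) {x : Esp n} (hx : x ≠ 0) : HasFDerivAt (Tm n u) (fderiv ℝ (Tm n u) x) x :=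
  ((G.Tm_cd hx).differentiableAt (by simp)).hasFDerivAt

lemma Tm_fd (G : Good n u) {x : Esp n} (hx : x ≠ 0) (v w : Esp n) :
    ⟪fderiv ℝ (Tm n u) x v, w⟫ = fderiv ℝ u x v * fderiv ℝ u x w + u x * fderiv ℝ (fderiv ℝ u) x v w := by
  have h1 : HasFDerivAt (fun y => ⟪Tm n u y, w⟫) (((innerSL ℝ w).comp (fderiv ℝ (Tm n u) x))) x := by
    have := (innerSL ℝ w).hasFDerivAt.comp x (G.Tm_hd hx)
    refine this.congr_of_eventuallyEq (Filter.Eventually.of_forall fun y => ?_)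
    simp [real_inner_comm]
  have h2 : HasFDerivAt (fun y => ⟪Tm n u y, w⟫) (u x • (fderiv ℝ (fderiv ℝ u) x).flip w + fderiv ℝ u x w • fderiv ℝ u x) x := by
    have := (G.hd hx).mul (G.hd2v hx w)
    refine this.congr_of_eventuallyEq (Filter.Eventually.of_forall fun y => ?_)
    exact G.Tm_inner y w
  have := congrArg (fun L => L v) (h1.unique h2)
  simp at this
  rw [real_inner_comm, this]; ring

lemma Tm_fd_smul (G : Good n u) {x : Esp n} (hx : x ≠ 0) {r : ℝ} (hr : 0 < r) :
    fderiv ℝ (Tm n u) (r • x) = fderiv ℝ (Tm n u) x := by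
  ext1 v
  refine ext_inner_right ℝ fun w => ?_
  have hrx := smul_ne_zero hr.ne' hx
  rw [G.Tm_fd hx, G.Tm_fd hrx, G.hom r hr, G.fderiv_smul hx hr, ← G.fderiv2_smul hx hr]; ring

lemma det_eq (G : Good n u) {x : Esp n} (hx : x ∈ sphere (0 : Esp n) 1) :
    (fderiv ℝ (Tm n u) x).det = u x ^ (n + 2) * sigmaElem n n u x := by
  have hx0 : x ≠ 0 := by rintro rfl; simp at hx
  have hx1 : ‖x‖ = 1 := by simpa using hx
  let p : Fin (n+1) → ℝ := fun i => fderiv ℝ u x (EuclideanSpace.single i 1)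
  have hsum : x = ∑ i, x i • (EuclideanSpace.single i (1:ℝ) : Esp n) := by
    have := (EuclideanSpace.basisFun (Fin (n+1)) ℝ).sum_repr x
    simpa using this.symm
  have hxx : (x : Fin (n+1) → ℝ) ⬝ᵥ x = 1 := by
    have := EuclideanSpace.real_norm_sq_eq x
    rw [hx1] at this
    simp only [dotProduct, ← pow_two]
    linarith
  have hpx : p ⬝ᵥ x = u x := by
    rw [← G.euler hx0]
    conv_rhs => rw [hsum]
    simp only [map_sum, map_smul, smul_eq_mul, dotProduct, p]
    rw [← hsum]
    exact Finset.sum_congr rfl fun i _ => mul_comm _ _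
  have hM1 : (hessMatrix n u x).mulVec x = 0 := by
    ext i
    have : fderiv ℝ (fderiv ℝ u) x (EuclideanSpace.single i 1) x = 0 := by
      rw [G.sym hx0, G.euler2 hx0]; simp
    simp only [Matrix.mulVec, dotProduct, hessMatrix, Matrix.of_apply, G.hess_eq hx0, Pi.zero_apply]
    rw [← this]
    generalize fderiv ℝ (fderiv ℝ u) x (EuclideanSpace.single i 1) = L
    conv_rhs => rw [hsum]
    simp only [map_sum, map_smul, smul_eq_mul]
    exact Finset.sum_congr rfl fun i _ => mul_comm _ _
  have hMs : (hessMatrix n u x).transpose = hessMatrix n u x := by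
    ext i j
    simp only [Matrix.transpose_apply, hessMatrix, Matrix.of_apply, G.hess_eq hx0]
    exact G.sym hx0 _ _
  have hM2 : Matrix.vecMul x (hessMatrix n u x) = 0 := by
    rw [← Matrix.mulVec_transpose, hMs, hM1]
  have hdet := det_rank_one (hessMatrix n u x) x p hxx hM1 hM2 (u x) (G.upos hx0).ne'
  have hmat : LinearMap.toMatrix (EuclideanSpace.basisFun (Fin (n+1)) ℝ).toBasis (EuclideanSpace.basisFun (Fin (n+1)) ℝ).toBasis
      (fderiv ℝ (Tm n u) x : Esp n →ₗ[ℝ] Esp n) = u x • hessMatrix n u x + Matrix.vecMulVec p p := by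
    ext i j
    rw [LinearMap.toMatrix_apply]
    have e : ((EuclideanSpace.basisFun (Fin (n+1)) ℝ).toBasis.repr (fderiv ℝ (Tm n u) x (EuclideanSpace.single j 1))) i
      = ⟪fderiv ℝ (Tm n u) x (EuclideanSpace.single j 1), EuclideanSpace.single i 1⟫ := by
      simp [EuclideanSpace.inner_single_right]
    simp only [OrthonormalBasis.coe_toBasis, EuclideanSpace.basisFun_apply, ContinuousLinearMap.coe_coe]
    rw [e, G.Tm_fd hx0]
    simp only [Matrix.add_apply, Matrix.smul_apply, hessMatrix, Matrix.of_apply, G.hess_eq hx0, Matrix.vecMulVec_apply, smul_eq_mul, p]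
    rw [G.sym hx0]; ring
  rw [ContinuousLinearMap.det, ← LinearMap.det_toMatrix (EuclideanSpace.basisFun (Fin (n+1)) ℝ).toBasis, hmat, hdet, hpx, sigmaElem,
    Nat.add_sub_cancel_left]
  ring

end Good
end Analysis

section Volumes
open scoped Pointwise

/-- admissible Wulff functions -/
structure Wf (n : ℕ) (g : Esp n → ℝ) : Prop where
  hom : PosHom n g
  cont : ContinuousOn g {(0 : Esp n)}ᶜ
  pos : ∀ x, x ≠ 0 → 0 < g x

def Dj (n : ℕ) (u : Esp n → ℝ) (x : Esp n) : ℝ := |(fderiv ℝ (Tm n u) x).det|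

def Sg (n : ℕ) (u g : Esp n → ℝ) : Set (Esp n) := {x | x ≠ 0 ∧ u x ^ 2 ≤ g x}

def Iv (n : ℕ) (u g : Esp n → ℝ) : ℝ :=
  ∫ θ : sphere (0 : Esp n) 1, Dj n u θ * ((g θ / u θ ^ 2) ^ (n + 1) / (n + 1))
    ∂(volume : Measure (Esp n)).toSphere

variable {n : ℕ} {u g : Esp n → ℝ}

lemma sph_ne (θ : sphere (0 : Esp n) 1) : (θ : Esp n) ≠ 0 := by
  intro h
  have := θ.2
  rw [h] at this
  simp at this

lemma sph_cont {Y : Type*} [TopologicalSpace Y] {f : Esp n → Y}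
    (hf : ContinuousOn f {(0 : Esp n)}ᶜ) :
    Continuous fun θ : sphere (0 : Esp n) 1 => f θ :=
  hf.comp_continuous continuous_subtype_val fun θ => sph_ne θ

lemma sph_int {f : sphere (0 : Esp n) 1 → ℝ} (hf : Continuous f) :
    Integrable f (volume : Measure (Esp n)).toSphere :=
  hf.integrable_of_hasCompactSupport (HasCompactSupport.of_compactSpace f)

lemma Good.wf (G : Good n u) : Wf n u := ⟨G.hom, G.sm.continuousOn, fun _ hx => G.upos hx⟩

lemma Good.Dj_cont (G : Good n u) : ContinuousOn (Dj n u) {(0 : Esp n)}ᶜ := by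
  intro x hx
  have h1 : ContinuousAt (fderiv ℝ (Tm n u)) x :=
    ((G.Tm_cd hx).fderiv_right (m := 0) (by simp)).continuousAt
  have h2 : ContinuousAt (fun x => (fderiv ℝ (Tm n u) x).det) x :=
    ContinuousAt.comp (g := fun f : Esp n →L[ℝ] Esp n => f.det)
      ContinuousLinearMap.continuous_det.continuousAt h1
  exact h2.abs.continuousWithinAt

lemma Dj_nonneg (x : Esp n) : 0 ≤ Dj n u x := abs_nonneg _

lemma Dj_meas : Measurable (fun x => ENNReal.ofReal (Dj n u x)) := by
  have h1 : Measurable (fun x => (fderiv ℝ (Tm n u) x).det) :=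
    ContinuousLinearMap.continuous_det.measurable.comp (measurable_fderiv ℝ _)
  exact ENNReal.measurable_ofReal.comp (continuous_abs.measurable.comp h1)

lemma Sg_meas (hu : Wf n u) (hg : Wf n g) : MeasurableSet (Sg n u g) := by
  have h1 := measurable_of_continuousOn_compl_singleton 0 hu.cont
  have h2 := measurable_of_continuousOn_compl_singleton 0 hg.cont
  exact (measurableSet_singleton (0 : Esp n)).compl.inter
    (measurableSet_le (h1.pow_const 2) h2)

lemma Iv_cont (G : Good n u) (hg : Wf n g) : Continuous fun θ : sphere (0 : Esp n) 1 =>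
    Dj n u θ * ((g θ / u θ ^ 2) ^ (n + 1) / (n + 1)) := by
  have h1 := sph_cont G.Dj_cont
  have h2 := sph_cont hg.cont
  have h3 := sph_cont G.wf.cont
  have h4 : ∀ θ : sphere (0 : Esp n) 1, u θ ^ 2 ≠ 0 := fun θ =>
    pow_ne_zero _ (G.upos (sph_ne θ)).ne'
  have := h2.div (h3.pow 2) h4
  exact h1.mul ((this.pow (n+1)).div_const _)

lemma Iv_nonneg (G : Good n u) (hg : Wf n g) : 0 ≤ Iv n u g := by
  refine integral_nonneg fun θ => ?_
  have := (G.upos (sph_ne θ))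
  have := (hg.pos _ (sph_ne θ))
  have := Dj_nonneg (u := u) (θ : Esp n)
  positivity

lemma lint_eq (G : Good n u) (hg : Wf n g) :
    ∫⁻ x in Sg n u g, ENNReal.ofReal (Dj n u x) = ENNReal.ofReal (Iv n u g) := by
  rw [polar (Sg n u g) (Sg_meas G.wf hg) (fun θ => g θ / u θ ^ 2) ?_ ?_ _ Dj_meas ?_]
  · rw [Iv, ofReal_integral_eq_lintegral_ofReal (sph_int (Iv_cont G hg))]
    · refine lintegral_congr fun θ => ?_
      rw [ENNReal.ofReal_mul (Dj_nonneg _)]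
    · refine Filter.Eventually.of_forall fun θ => ?_
      have := (G.upos (sph_ne θ))
      have := (hg.pos _ (sph_ne θ))
      have := Dj_nonneg (u := u) (θ : Esp n)
      simp only [Pi.zero_apply]
      positivity
  · intro θ
    have := (G.upos (sph_ne θ))
    have := (hg.pos _ (sph_ne θ))
    positivity
  · intro θ r hr
    have h1 := (G.upos (sph_ne θ))
    have h2 : r • (θ : Esp n) ≠ 0 := smul_ne_zero hr.ne' (sph_ne θ)
    rw [le_div_iff₀ (by positivity)]
    simp only [Sg, Set.mem_ofPred_eq, G.hom r hr, hg.hom r hr]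
    constructor
    · rintro ⟨_, h⟩
      have : r * (r * u θ ^ 2) ≤ r * g θ := by nlinarith
      exact le_of_mul_le_mul_left this hr
    · intro h
      refine ⟨h2, ?_⟩
      have := mul_le_mul_of_nonneg_left h hr.le
      nlinarith
  · intro r hr x hx
    rw [Dj, Dj, G.Tm_fd_smul hx hr]

lemma body_closed : IsClosed (body n u) := by
  have : body n u = ⋂ x, {y | ⟪x, y⟫ ≤ u x} := by ext y; simp [body]
  rw [this]
  exact isClosed_iInter fun x => isClosed_le (by fun_prop) continuous_const

lemma V1 (G : Good n u) : ENNReal.ofReal (Iv n u u) ≤ volume (body n u) := by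
  rw [← lint_eq G G.wf]
  have := lintegral_abs_det_fderiv_eq_addHaar_image (f := Tm n u) (f' := fderiv ℝ (Tm n u)) volume
    (Sg_meas G.wf G.wf) (fun x hx => (G.Tm_hd hx.1).hasFDerivWithinAt)
    (G.inj.mono fun x hx => hx.1)
  unfold Dj
  rw [this]
  refine measure_mono ?_
  rintro _ ⟨x, ⟨hx, hux⟩, rfl⟩ z
  have hp := G.upos hx
  have h1 : u x ≤ 1 := by nlinarith
  rw [real_inner_comm, G.Tm_inner]
  have h2 := G.le hx z
  have hz : 0 ≤ u z := by
    rcases eq_or_ne z 0 with rfl | hz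
    · rw [hom_zero G.hom]
    · exact (G.upos hz).le
  nlinarith

lemma V2 (G : Good n u) (hg : Wf n g) : volume (body n g) ≤ ENNReal.ofReal (Iv n u g) := by
  rw [← lint_eq G hg]
  have h := addHaar_image_le_lintegral_abs_det_fderiv (f := Tm n u) (f' := fderiv ℝ (Tm n u)) volume
    (Sg_meas G.wf hg) (fun x hx => (G.Tm_hd hx.1).hasFDerivWithinAt)
  unfold Dj
  refine le_trans ?_ h
  have hsub : body n g ⊆ Tm n u '' Sg n u g ∪ {0} := by
    intro y hy
    rcases eq_or_ne y 0 with rfl | h0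
    · right; rfl
    · left
      obtain ⟨x, hx, rfl⟩ := G.surj h0
      refine ⟨x, ⟨hx, ?_⟩, rfl⟩
      have := hy x
      rw [real_inner_comm, G.Tm_inner, G.euler hx] at this
      linarith
  refine (measure_mono hsub).trans ((measure_union_le _ _).trans ?_)
  simp

lemma vol_eq (G : Good n u) : volume (body n u) = ENNReal.ofReal (Iv n u u) :=
  le_antisymm (V2 G G.wf) (V1 G)

lemma pow_bound (R : ℝ) (hR : 0 ≤ R) (N : ℕ) : ∃ C : ℝ, 0 ≤ C ∧ ∀ s, -1 ≤ s → s ≤ R →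
    (1 + s) ^ N ≤ 1 + N * s + C * s ^ 2 := by
  induction N with
  | zero => exact ⟨0, le_rfl, fun s _ _ => by simp⟩
  | succ N ih =>
    obtain ⟨C, hC, h⟩ := ih
    refine ⟨C * (1 + R) + N, by positivity, fun s h1 h2 => ?_⟩
    have h3 := mul_le_mul_of_nonneg_right (h s h1 h2) (show 0 ≤ 1 + s by linarith)
    rw [pow_succ]
    push_cast
    have h4 : 0 ≤ C * s ^ 2 * (R - s) := by
      have : 0 ≤ R - s := by linarith
      positivity
    nlinarith

lemma mink (G : Good n u) (hg : Wf n g) (hv : volume (body n u) ≤ volume (body n g)) :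
    0 ≤ ∫ θ : sphere (0 : Esp n) 1, Dj n u θ / u θ ^ (n + 1) * (g θ / u θ - 1)
      ∂(volume : Measure (Esp n)).toSphere := by
  have hcu := sph_cont G.wf.cont
  have hcg := sph_cont hg.cont
  have hcD := sph_cont G.Dj_cont
  have hup : ∀ θ : sphere (0 : Esp n) 1, 0 < u θ := fun θ => G.upos (sph_ne θ)
  have hgp : ∀ θ : sphere (0 : Esp n) 1, 0 < g θ := fun θ => hg.pos _ (sph_ne θ)
  have hw : Continuous fun θ : sphere (0 : Esp n) 1 => g θ / u θ := hcg.div hcu fun θ => (hup θ).ne'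
  have hm : Continuous fun θ : sphere (0 : Esp n) 1 => Dj n u θ / u θ ^ (n + 1) :=
    hcD.div (hcu.pow _) fun θ => (pow_pos (hup θ) _).ne'
  obtain ⟨R0, hR0⟩ := isCompact_univ.exists_bound_of_continuousOn hw.continuousOn
  set R := max R0 0 with hRdef
  have hR : 0 ≤ R := le_max_right _ _
  obtain ⟨C, hC, hCb⟩ := pow_bound R hR (n + 1)
  have i1 := sph_int (Iv_cont G G.wf)
  have i2 : Integrable (fun θ : sphere (0 : Esp n) 1 => Dj n u θ / u θ ^ (n + 1) * (g θ / u θ - 1))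
      (volume : Measure (Esp n)).toSphere := sph_int (hm.mul (hw.sub continuous_const))
  have i3 : Integrable (fun θ : sphere (0 : Esp n) 1 =>
      Dj n u θ / u θ ^ (n + 1) * (C / (n + 1) * (g θ / u θ - 1) ^ 2))
      (volume : Measure (Esp n)).toSphere :=
    sph_int (hm.mul (continuous_const.mul ((hw.sub continuous_const).pow 2)))
  set A := ∫ θ : sphere (0 : Esp n) 1, Dj n u θ / u θ ^ (n + 1) * (g θ / u θ - 1)
      ∂(volume : Measure (Esp n)).toSphere with hA
  set B := ∫ θ : sphere (0 : Esp n) 1, Dj n u θ / u θ ^ (n + 1) * (C / (n + 1) * (g θ / u θ - 1) ^ 2)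
      ∂(volume : Measure (Esp n)).toSphere with hB
  have key : ∀ t : ℝ, 0 < t → t < 1 → 0 ≤ A + t * B := by
    intro t ht0 ht1
    have ht1' : 0 < 1 - t := by linarith
    let gt : Esp n → ℝ := fun x => (1 - t) * u x + t * g x
    have hgt : Wf n gt := by
      refine ⟨?_, ?_, ?_⟩
      · intro r hr x
        simp only [gt, G.hom r hr, hg.hom r hr]; ring
      · exact (continuousOn_const.mul G.wf.cont).add (continuousOn_const.mul hg.cont)
      · intro x hx
        have := G.upos hx
        have := hg.pos x hx
        simp only [gt]
        positivity
    have hbm := bm ht0 ht1 (body_closed (u := u)).measurableSet (body_closed (u := g)).measurableSet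
      (body_closed (u := gt)).measurableSet (by
        intro a ha b hb x
        rw [inner_add_right, real_inner_smul_right, real_inner_smul_right]
        exact add_le_add (mul_le_mul_of_nonneg_left (ha x) ht1'.le)
          (mul_le_mul_of_nonneg_left (hb x) ht0.le))
    have h1 : volume (body n u) ≤ volume (body n gt) := by
      refine le_trans ?_ hbm
      calc volume (body n u) = volume (body n u) ^ (1 - t) * volume (body n u) ^ t := by
            rw [← ENNReal.rpow_add_of_nonneg _ _ ht1'.le ht0.le]; simp
        _ ≤ _ := by gcongr
    rw [vol_eq G] at h1
    have h2 := h1.trans (V2 G hgt)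
    rw [ENNReal.ofReal_le_ofReal_iff (Iv_nonneg G hgt)] at h2
    have i12 : Integrable (fun θ : sphere (0 : Esp n) 1 =>
        Dj n u θ * ((u θ / u θ ^ 2) ^ (n + 1) / (n + 1)) +
          t * (Dj n u θ / u θ ^ (n + 1) * (g θ / u θ - 1)))
        (volume : Measure (Esp n)).toSphere := i1.add (i2.const_mul t)
    have h3 : Iv n u gt ≤ Iv n u u + t * A + t ^ 2 * B := by
      rw [Iv, Iv, hA, hB, ← integral_const_mul, ← integral_const_mul, ← integral_add i1 (i2.const_mul t),
        ← integral_add i12 (i3.const_mul _)]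
      refine integral_mono (sph_int (Iv_cont G hgt)) (i12.add (i3.const_mul _)) ?_
      intro θ
      have hu := hup θ
      have hgg := hgp θ
      have hwp : 0 < g θ / u θ := div_pos hgg hu
      have hwR : g θ / u θ ≤ R := by
        have := hR0 θ (Set.mem_univ _)
        exact (le_abs_self _).trans (this.trans (le_max_left _ _))
      have hb := hCb (t * (g θ / u θ - 1)) (by nlinarith) (by nlinarith)
      have e1 : (gt θ / u θ ^ 2) ^ (n + 1) = (1 + t * (g θ / u θ - 1)) ^ (n + 1) / u θ ^ (n + 1) := by
        rw [← div_pow]; congr 1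
        simp only [gt]; field_simp; ring
      have e2 : (u θ / u θ ^ 2) ^ (n + 1) = 1 / u θ ^ (n + 1) := by
        rw [← one_div_pow]; congr 1; field_simp
      simp only
      rw [e1, e2]
      have hD := Dj_nonneg (u := u) (θ : Esp n)
      have hn1 : (0:ℝ) < n + 1 := by positivity
      have hc : 0 ≤ Dj n u θ / u θ ^ (n + 1) / (n + 1) := by positivity
      have := mul_le_mul_of_nonneg_left hb hc
      push_cast at this
      calc _ = Dj n u θ / u θ ^ (n + 1) / (n + 1) * (1 + t * (g θ / u θ - 1)) ^ (n + 1) := by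
            field_simp
        _ ≤ _ := this
        _ = _ := by
          generalize g θ / u θ - 1 = s
          field_simp
    nlinarith
  by_contra hneg
  push Not at hneg
  have hBt := key (min (1/2) (-A / (2 * (|B| + 1)))) (by
      refine lt_min (by norm_num) (div_pos (by linarith) (by positivity))) (by
      exact (min_le_left _ _).trans_lt (by norm_num))
  set t := min (1/2) (-A / (2 * (|B| + 1))) with htd
  have ht0 : 0 < t := lt_min (by norm_num) (div_pos (by linarith) (by positivity))
  have htA : t * (2 * (|B| + 1)) ≤ -A := by
    rw [← le_div_iff₀ (by positivity)]; exact min_le_right _ _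
  have : t * B ≤ t * |B| := mul_le_mul_of_nonneg_left (le_abs_self _) ht0.le
  have : 0 ≤ t * |B| := by positivity
  nlinarith

lemma body_smul {a : ℝ} (ha : 0 < a) : body n (fun x => a * g x) = a • body n g := by
  ext y
  rw [Set.mem_smul_set_iff_inv_smul_mem₀ ha.ne']
  simp only [body, Set.mem_ofPred_eq]
  refine forall_congr' fun x => ?_
  rw [real_inner_smul_right, inv_mul_le_iff₀ ha]

lemma Wf.smul (hg : Wf n g) {a : ℝ} (ha : 0 < a) : Wf n (fun x => a * g x) := by
  refine ⟨fun r hr x => ?_, continuousOn_const.mul hg.cont, fun x hx => mul_pos ha (hg.pos x hx)⟩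
  simp only [hg.hom r hr]; ring

lemma vol_smul {a : ℝ} (ha : 0 < a) :
    volume (body n (fun x => a * g x)) = ENNReal.ofReal (a ^ (n + 1)) * volume (body n g) := by
  rw [body_smul ha, Measure.addHaar_smul, finrank_euclideanSpace_fin, abs_of_pos (by positivity)]

lemma zero_of_int {f : sphere (0 : Esp n) 1 → ℝ} (hf : Continuous f) (h0 : ∀ θ, 0 ≤ f θ)
    (hi : ∫ θ, f θ ∂(volume : Measure (Esp n)).toSphere ≤ 0) (θ : sphere (0 : Esp n) 1) :
    f θ = 0 := by
  have h1 : ∫ θ, f θ ∂(volume : Measure (Esp n)).toSphere = 0 :=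
    le_antisymm hi (integral_nonneg h0)
  rw [integral_eq_zero_iff_of_nonneg h0 (sph_int hf)] at h1
  have := (hf.ae_eq_iff_eq _ continuous_const).1 h1
  exact congrFun this θ

lemma Iv_pos (G : Good n u) (hD : ∀ θ : sphere (0 : Esp n) 1, 0 < Dj n u θ) : 0 < Iv n u u := by
  by_contra hc
  push Not at hc
  have hp : ∀ θ : sphere (0 : Esp n) 1,
      0 < Dj n u θ * ((u θ / u θ ^ 2) ^ (n + 1) / (n + 1)) := by
    intro θ
    have := G.upos (sph_ne θ)
    have := hD θ
    positivity
  have hs : (EuclideanSpace.single 0 1 : Esp n) ∈ sphere (0 : Esp n) 1 := by simp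
  have := zero_of_int (Iv_cont G G.wf) (fun θ => (hp θ).le) hc ⟨_, hs⟩
  exact (hp ⟨_, hs⟩).ne' this

end Volumes

/-- anisotropic remark.  Let `φ : (0,∞) → (0,∞)` be `C¹` with `φ' > 0`.
If `K, L` are smooth, strictly convex bodies in `ℝ^{n+1}` with positive support functions
`h_K, h_L` and Gauss curvatures `𝒦_K, 𝒦_L` satisfying `𝒦_L/𝒦_K = φ(h_K/h_L)` on `𝕊ⁿ`,
then `K` is a rescaling of `L`. -/
theorem statement_7 (n : ℕ) (hn : 1 ≤ n)
    (φ : ℝ → ℝ)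
    (hφC1 : ContDiffOn ℝ 1 φ (Set.Ioi 0))
    (hφpos : ∀ x : ℝ, 0 < x → 0 < φ x)
    (hφ' : ∀ x : ℝ, 0 < x → 0 < deriv φ x)
    (hK hL 𝒦K 𝒦L : Esp n → ℝ)
    (hKsm : ContDiffOn ℝ (⊤ : ℕ∞) hK {(0 : Esp n)}ᶜ)
    (hLsm : ContDiffOn ℝ (⊤ : ℕ∞) hL {(0 : Esp n)}ᶜ)
    (hKhom : PosHom n hK) (hLhom : PosHom n hL)
    (hKconv : ∀ x ∈ sphere (0 : Esp n) 1, ∀ v : Esp n,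
      ⟪v, x⟫ = 0 → v ≠ 0 → 0 < hessForm n hK x v v)
    (hLconv : ∀ x ∈ sphere (0 : Esp n) 1, ∀ v : Esp n,
      ⟪v, x⟫ = 0 → v ≠ 0 → 0 < hessForm n hL x v v)
    (hKpos : ∀ x ∈ sphere (0 : Esp n) 1, 0 < hK x)
    (hLpos : ∀ x ∈ sphere (0 : Esp n) 1, 0 < hL x)
    (hKGauss : ∀ x ∈ sphere (0 : Esp n) 1, (𝒦K x)⁻¹ = sigmaElem n n hK x)
    (hLGauss : ∀ x ∈ sphere (0 : Esp n) 1, (𝒦L x)⁻¹ = sigmaElem n n hL x)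
    (heq : ∀ x ∈ sphere (0 : Esp n) 1, 𝒦L x / 𝒦K x = φ (hK x / hL x)) :
    ∃ c : ℝ, 0 < c ∧ ∀ x ∈ sphere (0 : Esp n) 1, hK x = c * hL x := by
  have GK : Good n hK := ⟨hKsm, hKhom, hKconv, hKpos⟩
  have PL : Good n hL := ⟨hLsm, hLhom, hLconv, hLpos⟩
  have hkp : ∀ θ : sphere (0 : Esp n) 1, 0 < hK θ := fun θ => hKpos θ θ.2
  have hlp : ∀ θ : sphere (0 : Esp n) 1, 0 < hL θ := fun θ => hLpos θ θ.2
  have hvp : ∀ θ : sphere (0 : Esp n) 1, 0 < hK θ / hL θ := fun θ => div_pos (hkp θ) (hlp θ)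
  have hfp : ∀ θ : sphere (0 : Esp n) 1, 0 < φ (hK θ / hL θ) := fun θ => hφpos _ (hvp θ)
  have hKne : ∀ θ : sphere (0 : Esp n) 1, 𝒦K θ ≠ 0 ∧ 𝒦L θ ≠ 0 := by
    intro θ
    have h1 := heq θ θ.2
    have h2 := hfp θ
    constructor
    · intro h; rw [h, div_zero] at h1; linarith
    · intro h; rw [h, zero_div] at h1; linarith
  have hDK : ∀ θ : sphere (0 : Esp n) 1, Dj n hK θ = hK θ ^ (n + 2) * |(𝒦K θ)⁻¹| := by
    intro θ
    rw [Dj, GK.det_eq θ.2, ← hKGauss θ θ.2, abs_mul, abs_of_pos (pow_pos (hkp θ) _)]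
  have hDL : ∀ θ : sphere (0 : Esp n) 1, Dj n hL θ = hL θ ^ (n + 2) * |(𝒦L θ)⁻¹| := by
    intro θ
    rw [Dj, PL.det_eq θ.2, ← hLGauss θ θ.2, abs_mul, abs_of_pos (pow_pos (hlp θ) _)]
  have hDKp : ∀ θ : sphere (0 : Esp n) 1, 0 < Dj n hK θ := by
    intro θ
    rw [hDK]
    exact mul_pos (pow_pos (hkp θ) _) (abs_pos.2 (inv_ne_zero (hKne θ).1))
  have hDLp : ∀ θ : sphere (0 : Esp n) 1, 0 < Dj n hL θ := by
    intro θ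
    rw [hDL]
    exact mul_pos (pow_pos (hlp θ) _) (abs_pos.2 (inv_ne_zero (hKne θ).2))
  have hrel : ∀ θ : sphere (0 : Esp n) 1, Dj n hK θ / hK θ ^ (n + 1)
      = hK θ / hL θ * φ (hK θ / hL θ) * (Dj n hL θ / hL θ ^ (n + 1)) := by
    intro θ
    have h1 : (𝒦K θ)⁻¹ = φ (hK θ / hL θ) * (𝒦L θ)⁻¹ := by
      rw [← heq θ θ.2]
      have := hKne θ
      field_simp [this.1, this.2]
    rw [hDK, hDL, h1, abs_mul, abs_of_pos (hfp θ)]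
    have := (hkp θ).ne'
    have := (hlp θ).ne'
    generalize φ (hK θ / hL θ) = z
    field_simp
    ring
  -- continuity
  have cK := sph_cont GK.wf.cont
  have cL := sph_cont PL.wf.cont
  have cD := sph_cont PL.Dj_cont
  have cv : Continuous fun θ : sphere (0 : Esp n) 1 => hK θ / hL θ :=
    cK.div cL fun θ => (hlp θ).ne'
  have cf : Continuous fun θ : sphere (0 : Esp n) 1 => φ (hK θ / hL θ) :=
    hφC1.continuousOn.comp_continuous cv fun θ => hvp θ
  have cm : Continuous fun θ : sphere (0 : Esp n) 1 => Dj n hL θ / hL θ ^ (n + 1) :=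
    cD.div (cL.pow _) fun θ => (pow_pos (hlp θ) _).ne'
  have hmp : ∀ θ : sphere (0 : Esp n) 1, 0 < Dj n hL θ / hL θ ^ (n + 1) :=
    fun θ => div_pos (hDLp θ) (pow_pos (hlp θ) _)
  have hVK := Iv_pos GK hDKp
  have hVL := Iv_pos PL hDLp
  set VK := Iv n hK hK with hVKd
  set VL := Iv n hL hL with hVLd
  obtain ⟨a, ha, haN⟩ : ∃ a : ℝ, 0 < a ∧ a ^ (n + 1) = VK / VL := by
    refine ⟨(VK / VL) ^ ((n + 1 : ℕ) : ℝ)⁻¹, Real.rpow_pos_of_pos (div_pos hVK hVL) _, ?_⟩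
    exact Real.rpow_inv_natCast_pow (div_pos hVK hVL).le (Nat.succ_ne_zero n)
  have m1 := mink GK (PL.wf.smul ha) (by
    rw [vol_smul ha, vol_eq GK, vol_eq PL, ← ENNReal.ofReal_mul (by positivity), haN,
      ← hVKd, ← hVLd, div_mul_cancel₀ _ hVL.ne'])
  have m2 := mink PL (GK.wf.smul (inv_pos.2 ha)) (by
    rw [vol_smul (inv_pos.2 ha), vol_eq GK, vol_eq PL, ← ENNReal.ofReal_mul (by positivity), inv_pow,
      haN, ← hVKd, ← hVLd, inv_div, div_mul_cancel₀ _ hVK.ne'])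
  have hmono : StrictMonoOn φ (Set.Ioi 0) := by
    refine strictMonoOn_of_deriv_pos (convex_Ioi 0) hφC1.continuousOn ?_
    intro x hx
    rw [interior_Ioi] at hx
    exact hφ' x hx
  have hprod : ∀ x : ℝ, 0 < x → x ≠ a → 0 < (x - a) * (φ x - φ a) := by
    intro x hx hne
    rcases lt_or_gt_of_ne hne with h | h
    · have := hmono hx ha h
      nlinarith
    · have := hmono ha hx h
      nlinarith
  have hprod' : ∀ x : ℝ, 0 < x → 0 ≤ (x - a) * (φ x - φ a) := by
    intro x hx
    rcases eq_or_ne x a with rfl | h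
    · simp
    · exact (hprod x hx h).le
  refine ⟨a, ha, fun x hx => ?_⟩
  let F : sphere (0 : Esp n) 1 → ℝ := fun θ =>
    (hK θ / hL θ - a) * (φ (hK θ / hL θ) - φ a) * (Dj n hL θ / hL θ ^ (n + 1))
  have cF : Continuous F := ((cv.sub continuous_const).mul (cf.sub continuous_const)).mul cm
  have hF0 : ∀ θ, 0 ≤ F θ := fun θ => mul_nonneg (hprod' _ (hvp θ)) (hmp θ).le
  let f1 : sphere (0 : Esp n) 1 → ℝ := fun θ =>
    (a * φ (hK θ / hL θ) - hK θ / hL θ * φ (hK θ / hL θ)) * (Dj n hL θ / hL θ ^ (n + 1))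
  let f2 : sphere (0 : Esp n) 1 → ℝ := fun θ =>
    (Dj n hL θ / hL θ ^ (n + 1)) * (a⁻¹ * (hK θ / hL θ) - 1)
  have c1 : Continuous f1 := ((continuous_const.mul cf).sub (cv.mul cf)).mul cm
  have c2 : Continuous f2 := cm.mul ((continuous_const.mul cv).sub continuous_const)
  have e1 : 0 ≤ ∫ θ, f1 θ ∂(volume : Measure (Esp n)).toSphere := by
    refine m1.trans_eq (integral_congr_ae (Filter.Eventually.of_forall fun θ => ?_))
    simp only [f1]
    rw [hrel]
    have := (hkp θ).ne'
    have := (hlp θ).ne'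
    generalize φ (hK θ / hL θ) = z
    field_simp
  have e2 : 0 ≤ ∫ θ, f2 θ ∂(volume : Measure (Esp n)).toSphere := by
    refine m2.trans_eq (integral_congr_ae (Filter.Eventually.of_forall fun θ => ?_))
    simp only [f2]
    rw [mul_div_assoc]
  have e3 : ∫ θ, F θ ∂(volume : Measure (Esp n)).toSphere ≤ 0 := by
    have : ∀ θ, F θ = -(f1 θ + (φ a * a) * f2 θ) := by
      intro θ
      simp only [F, f1, f2]
      generalize φ (hK θ / hL θ) = z
      generalize hK θ / hL θ = w
      have := ha.ne'
      field_simp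
      ring
    simp_rw [this]
    rw [integral_neg, integral_add (sph_int c1) ((sph_int c2).const_mul _), integral_const_mul]
    have := mul_nonneg (mul_nonneg (hφpos a ha).le ha.le) e2
    linarith
  have hz := zero_of_int cF hF0 e3 ⟨x, hx⟩
  have hxa : hK x / hL x = a := by
    by_contra hne
    have := mul_pos (hprod _ (hvp ⟨x, hx⟩) hne) (hmp ⟨x, hx⟩)
    exact this.ne' hz
  rw [← hxa, div_mul_cancel₀ _ (hLpos x hx).ne']
end
end
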